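/- arXiv:1604.00616 — 4 statements merged into one kernel-verified Lean document; each statement's English description precedes it below -/
import Mathlib

section
/- Let h_1, ..., h_s be vectors in ℝ^d that generate a dense additive subgroup of ℝ^d (i.e., the subgroup h_1ℤ + ... + h_sℤ is dense in ℝ^d). Let f : ℝ^d → ℂ be a continuous function such that for each i = 1, ..., s there is a natural number n_i with dim span{f, τ_{h_i}(f), ..., (τ_{h_i})^{n_i}(f)} ≤ n_i. Then f is an exponential polynomial. -/
open scoped BigOperators

namespace RadoMontel

lemma relation {X : Type*} [AddCommGroup X] (f : X → ℂ) (h : X) (n : ℕ)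
    (hr : Module.rank ℂ ↥(Submodule.span ℂ
        (Set.range fun k : Fin (n + 1) => fun x : X => f (x + (k : ℕ) • h))) ≤ n) :
    ∃ (m : ℕ) (c : ℕ → ℂ), 0 < m ∧
      ∀ x, f (x + m • h) = ∑ l ∈ Finset.range m, c l * f (x + l • h) := by
  have hnl : ¬ LinearIndependent ℂ (fun k : Fin (n + 1) => fun x : X => f (x + (k : ℕ) • h)) := by
    intro hli
    have h1 := finrank_span_eq_card hli
    have h2 := Module.finrank_le_of_rank_le hr
    rw [h1, Fintype.card_fin] at h2
    omega
  rw [Fintype.not_linearIndependent_iff] at hnl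
  obtain ⟨g, hg, i, hi⟩ := hnl
  set a : ℕ → ℂ := fun k => if hk : k < n + 1 then g ⟨k, hk⟩ else 0 with ha
  have hsum : ∀ x, ∑ k ∈ Finset.range (n + 1), a k * f (x + k • h) = 0 := by
    intro x
    have := congrFun hg x
    simp only [Finset.sum_apply, Pi.smul_apply, smul_eq_mul, Pi.zero_apply] at this
    rw [Finset.sum_range, ← this]
    refine Finset.sum_congr rfl fun k _ => ?_
    simp only [ha, k.2, dif_pos]
  have hai : a i ≠ 0 := by simpa only [ha, i.2, dif_pos] using hi
  have hin : (i : ℕ) ≤ n := by have := i.2; omega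
  clear_value a
  -- greatest index
  obtain ⟨m, hm, hmax⟩ : ∃ m, (m ≤ n ∧ a m ≠ 0) ∧ ∀ k, m < k → k ≤ n → a k = 0 := by
    classical
    refine ⟨Nat.findGreatest (fun k => a k ≠ 0) n, ⟨Nat.findGreatest_le n,
      Nat.findGreatest_spec (P := fun k => a k ≠ 0) hin hai⟩, ?_⟩
    intro k hk hkn
    by_contra hne
    exact Nat.findGreatest_is_greatest hk hkn hne
  have hsum' : ∀ x, ∑ k ∈ Finset.range (m + 1), a k * f (x + k • h) = 0 := by
    intro x
    rw [← hsum x]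
    apply Finset.sum_subset
    · intro k; simp only [Finset.mem_range]; omega
    · intro k hk hk'
      simp only [Finset.mem_range] at hk hk'
      rw [hmax k (by omega) (by omega), zero_mul]
  have hrel : ∀ x, f (x + m • h) = ∑ l ∈ Finset.range m, (-(a l / a m)) * f (x + l • h) := by
    intro x
    have h1 := hsum' x
    rw [Finset.sum_range_succ] at h1
    have h2 : ∑ l ∈ Finset.range m, (-(a l / a m)) * f (x + l • h)
        = -(1 / a m) * ∑ l ∈ Finset.range m, a l * f (x + l • h) := by
      rw [Finset.mul_sum]
      refine Finset.sum_congr rfl fun l _ => ?_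
      ring
    rw [h2, eq_neg_of_add_eq_zero_left h1]
    have := hm.2
    field_simp
  refine ⟨m + 1, fun l => if l = 0 then 0 else -(a (l - 1) / a m), Nat.succ_pos _, fun x => ?_⟩
  rw [Finset.sum_range_succ']
  have := hrel (x + h)
  simp only [Nat.add_sub_cancel, Nat.succ_ne_zero, if_false, if_true, zero_mul, add_zero]
  rw [succ_nsmul', ← add_assoc, this]
  refine Finset.sum_congr rfl fun l _ => ?_
  rw [succ_nsmul', ← add_assoc]

/-- translation -/
noncomputable def tr {X : Type*} [AddCommGroup X] (a : X) : (X → ℂ) →ₗ[ℂ] (X → ℂ) :=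
  LinearMap.funLeft ℂ ℂ (fun x => x + a)

@[simp] lemma tr_apply {X : Type*} [AddCommGroup X] (a : X) (g : X → ℂ) (x : X) :
    tr a g x = g (x + a) := rfl

lemma tr_add {X : Type*} [AddCommGroup X] (a b : X) (g : X → ℂ) :
    tr (a + b) g = tr a (tr b g) := by
  ext x; simp [add_assoc]

lemma sum_update {X : Type*} [AddCommGroup X] {s : ℕ} (h : Fin s → X) (k : Fin s → ℕ) (i : Fin s)
    (l : ℕ) : ∑ j, (Function.update k i l) j • h j
      = ∑ j, (Function.update k i 0) j • h j + l • h i := by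
  rw [← Finset.sum_erase_add _ _ (Finset.mem_univ i),
    ← Finset.sum_erase_add (a := i) Finset.univ (fun j => (Function.update k i 0) j • h j)
      (Finset.mem_univ i)]
  simp only [Function.update_self, zero_smul, add_zero]
  congr 1
  refine Finset.sum_congr rfl fun j hj => ?_
  rw [Function.update_of_ne (Finset.ne_of_mem_erase hj),
    Function.update_of_ne (Finset.ne_of_mem_erase hj)]

lemma exists_space {X : Type*} [AddCommGroup X] [TopologicalSpace X] [ContinuousAdd X]
    {s : ℕ} (h : Fin s → X)
    (hdense : Dense ((AddSubgroup.closure (Set.range h) : AddSubgroup X) : Set X))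
    (f : X → ℂ) (hf : Continuous f)
    (hrel : ∀ i : Fin s, ∃ (m : ℕ) (c : ℕ → ℂ), 0 < m ∧
      ∀ x, f (x + m • h i) = ∑ l ∈ Finset.range m, c l * f (x + l • h i)) :
    ∃ V : Submodule ℂ (X → ℂ), FiniteDimensional ℂ V ∧ f ∈ V ∧ (∀ g ∈ V, Continuous g) ∧
      ∀ a, ∀ g ∈ V, tr a g ∈ V := by
  choose m c hm hc using hrel
  set G : (Fin s → ℕ) → (X → ℂ) := fun k x => f (x + ∑ j, k j • h j) with hG
  set S : Set (Fin s → ℕ) := {k | ∀ i, k i < m i} with hS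
  have hSfin : S.Finite := by
    have := Set.Finite.pi' (fun i : Fin s => Set.finite_Iio (m i))
    exact this
  set V := Submodule.span ℂ (G '' S) with hV
  have hVfin : FiniteDimensional ℂ V := FiniteDimensional.span_of_finite ℂ (hSfin.image G)
  have hcont : ∀ g ∈ V, Continuous g := by
    intro g hg
    induction hg using Submodule.span_induction with
    | mem g hg => obtain ⟨k, -, rfl⟩ := hg; simp only [hG]; fun_prop
    | zero => exact continuous_const
    | add a b _ _ ha hb => exact ha.add hb
    | smul a b _ hb => exact hb.const_smul a
  have hGu : ∀ k i l x, G (Function.update k i l) x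
      = f (x + ∑ j, (Function.update k i 0) j • h j + l • h i) := by
    intro k i l x
    simp only [hG]
    rw [sum_update, add_assoc]
  have hstep : ∀ i, V ≤ V.comap (tr (h i)) := by
    intro i
    rw [hV, Submodule.span_le]
    rintro _ ⟨k, hk, rfl⟩
    have hu : ∀ l, l < m i → G (Function.update k i l) ∈ V := by
      intro l hl
      refine Submodule.subset_span ⟨_, ?_, rfl⟩
      intro j
      by_cases hj : j = i
      · subst hj; simpa using hl
      · rw [Function.update_of_ne hj]; exact hk j
    have e1 : tr (h i) (G k) = G (Function.update k i (k i + 1)) := by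
      ext x
      rw [hGu, tr_apply]
      conv_lhs => rw [← Function.update_eq_self i k]
      rw [hGu, succ_nsmul]
      congr 1
      abel
    show tr (h i) (G k) ∈ V
    rw [e1]
    by_cases hlt : k i + 1 < m i
    · exact hu _ hlt
    · have hki : k i + 1 = m i := by have := hk i; omega
      have e2 : G (Function.update k i (k i + 1))
          = ∑ l ∈ Finset.range (m i), c i l • G (Function.update k i l) := by
        ext x
        rw [hGu, hki, hc]
        simp only [Finset.sum_apply, Pi.smul_apply, smul_eq_mul, hGu]
      rw [e2]
      exact Submodule.sum_mem _ fun l hl => Submodule.smul_mem _ _ (hu l (Finset.mem_range.1 hl))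
  -- stabilizer
  let H : AddSubgroup X :=
    { carrier := {a | ∀ g ∈ V, tr a g ∈ V}
      zero_mem' := by intro g hg; convert hg; ext x; simp
      add_mem' := by
        intro a b ha hb g hg
        rw [tr_add]; exact ha _ (hb _ hg)
      neg_mem' := by
        intro a ha g hg
        have hinj : Function.Injective ((tr a).restrict ha) := by
          intro u v huv
          ext x
          have := congrFun (congrArg Subtype.val huv) (x - a)
          simpa [LinearMap.restrict_apply] using this
        obtain ⟨u, hu⟩ := (LinearMap.injective_iff_surjective.1 hinj) ⟨g, hg⟩
        have : tr (-a) g = u := by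
          have h2 : tr a (u : X → ℂ) = g := congrArg Subtype.val hu
          rw [← h2, ← tr_add]; ext x; simp
        rw [this]; exact u.2 }
  have hle : AddSubgroup.closure (Set.range h) ≤ H := by
    rw [AddSubgroup.closure_le]
    rintro _ ⟨i, rfl⟩ g hg
    exact hstep i hg
  have hclosed : IsClosed (V : Set (X → ℂ)) := Submodule.closed_of_finiteDimensional V
  refine ⟨V, hVfin, ?_, hcont, ?_⟩
  · refine Submodule.subset_span ⟨0, fun i => hm i, ?_⟩
    ext x; simp [hG]
  · intro a g hg
    have hcg := hcont g hg
    have hct : Continuous (fun a => tr a g) := by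
      refine continuous_pi fun x => ?_
      simp only [tr_apply]; fun_prop
    have hcl : IsClosed {a | tr a g ∈ V} := hclosed.preimage hct
    have : closure ((AddSubgroup.closure (Set.range h) : AddSubgroup X) : Set X)
        ⊆ {a | tr a g ∈ V} := hcl.closure_subset_iff.2 fun b hb => hle hb g hg
    exact this (hdense a)

/-- A continuous one-parameter group is differentiable. -/
lemma oneParam {A : Type*} [NormedRing A] [NormedAlgebra ℝ A] [CompleteSpace A]
    (M : ℝ → A) (hM : Continuous M) (h0 : M 0 = 1) (hadd : ∀ s t, M (s + t) = M s * M t) :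
    ∃ B, ∀ t, HasDerivAt M (M t * B) t := by
  set F : ℝ → A := fun t => ∫ s in (0:ℝ)..t, M s with hF
  have hFd : ∀ t, HasDerivAt F (M t) t := fun t =>
    intervalIntegral.integral_hasDerivAt_right (hM.intervalIntegrable _ _)
      hM.aestronglyMeasurable.stronglyMeasurableAtFilter hM.continuousAt
  have hF0 : F 0 = 0 := by simp [hF]
  obtain ⟨ε, hε⟩ : ∃ ε : ℝ, IsUnit (F ε) := by
    have h1 := (hFd 0).tendsto_slope_zero
    rw [h0] at h1
    have h2 : ∀ᶠ t in nhdsWithin (0:ℝ) {0}ᶜ, IsUnit (t⁻¹ • (F (0 + t) - F 0)) :=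
      h1.eventually (Units.isOpen.mem_nhds isUnit_one)
    obtain ⟨t, ht, ht0⟩ := (h2.and self_mem_nhdsWithin).exists
    refine ⟨t, ?_⟩
    have ht0 : t ≠ 0 := ht0
    rw [hF0, zero_add, sub_zero] at ht
    have := (IsUnit.mk0 t ht0).map (algebraMap ℝ A) |>.mul ht
    rwa [← Algebra.smul_def, smul_smul, mul_inv_cancel₀ ht0, one_smul] at this
  obtain ⟨u, hu⟩ := hε
  have key : ∀ t, M t = (F (t + ε) - F t) * (↑u⁻¹ : A) := by
    intro t
    rw [Units.eq_mul_inv_iff_mul_eq, hu]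
    have e1 : M t * F ε = ∫ s in (0:ℝ)..ε, M (t + s) := by
      simp only [hadd, hF]
      exact ((ContinuousLinearMap.mul ℝ A (M t)).intervalIntegral_comp_comm
        (hM.intervalIntegrable _ _)).symm
    rw [e1, intervalIntegral.integral_comp_add_left (fun s => M s) t, add_zero]
    exact (intervalIntegral.integral_interval_sub_left (hM.intervalIntegrable _ _)
      (hM.intervalIntegrable _ _)).symm
  have hd0 : DifferentiableAt ℝ M 0 := by
    have : M = fun t => (F (t + ε) - F t) * (↑u⁻¹ : A) := funext key
    rw [this]
    have hFD : Differentiable ℝ F := fun t => (hFd t).differentiableAt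
    fun_prop
  refine ⟨deriv M 0, fun t => ?_⟩
  have h1 : HasDerivAt (fun r => M (r - t)) (deriv M 0) t := by
    have := hd0.hasDerivAt
    rw [← sub_self t] at this
    simpa using this.comp_sub_const t t
  have h2 := h1.const_mul (M t)
  convert h2 using 1
  ext r
  rw [← hadd]; congr 1; ring

/-- exponential polynomials, with an arbitrary finite index type -/
def IsEP (d : ℕ) (g : (Fin d → ℝ) → ℂ) : Prop :=
  ∃ (ι : Type) (_ : Fintype ι) (lam : ι → (Fin d → ℂ)) (P : ι → MvPolynomial (Fin d) ℂ),
      ∀ x : Fin d → ℝ,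
        g x = ∑ j, (MvPolynomial.eval (fun k => (x k : ℂ)) (P j)) *
          Complex.exp (∑ k, lam j k * (x k : ℂ))

lemma IsEP.const {d : ℕ} (c : ℂ) : IsEP d (fun _ => c) :=
  ⟨Unit, inferInstance, fun _ => 0, fun _ => MvPolynomial.C c, fun x => by simp⟩

lemma IsEP.add {d : ℕ} {g g' : (Fin d → ℝ) → ℂ} (hg : IsEP d g) (hg' : IsEP d g') :
    IsEP d (fun x => g x + g' x) := by
  obtain ⟨ι, _, l, P, h⟩ := hg
  obtain ⟨ι', _, l', P', h'⟩ := hg'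
  refine ⟨ι ⊕ ι', inferInstance, Sum.elim l l', Sum.elim P P', fun x => ?_⟩
  simp only [h, h']
  rw [Fintype.sum_sum_type]
  simp

lemma IsEP.mul {d : ℕ} {g g' : (Fin d → ℝ) → ℂ} (hg : IsEP d g) (hg' : IsEP d g') :
    IsEP d (fun x => g x * g' x) := by
  obtain ⟨ι, _, l, P, h⟩ := hg
  obtain ⟨ι', _, l', P', h'⟩ := hg'
  refine ⟨ι × ι', inferInstance, fun p => l p.1 + l' p.2, fun p => P p.1 * P' p.2, fun x => ?_⟩
  simp only [h, h']
  rw [Fintype.sum_mul_sum, Fintype.sum_prod_type]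
  refine Finset.sum_congr rfl fun i _ => Finset.sum_congr rfl fun j _ => ?_
  simp only [Pi.add_apply, add_mul, Finset.sum_add_distrib, Complex.exp_add, map_mul]
  ring

lemma IsEP.sum {d : ℕ} {κ : Type*} (S : Finset κ) {g : κ → (Fin d → ℝ) → ℂ}
    (hg : ∀ i ∈ S, IsEP d (g i)) : IsEP d (fun x => ∑ i ∈ S, g i x) := by
  classical
  induction S using Finset.induction_on with
  | empty => simpa using IsEP.const 0
  | insert a S ha ih =>
    simp only [Finset.sum_insert ha]
    exact (hg a (by simp)).add (ih fun i hi => hg i (by simp [hi]))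

lemma IsEP.single {d : ℕ} (k : Fin d) (p : Polynomial ℂ) (μ : ℂ) :
    IsEP d (fun x => p.eval (x k : ℂ) * Complex.exp (μ * (x k : ℂ))) := by
  refine ⟨Unit, inferInstance, fun _ => Pi.single k μ,
    fun _ => Polynomial.aeval (MvPolynomial.X k) p, fun x => ?_⟩
  have h1 : MvPolynomial.eval (fun k => (x k : ℂ)) (Polynomial.aeval (MvPolynomial.X k) p)
      = p.eval (x k : ℂ) := by
    have := Polynomial.hom_eval₂ p (algebraMap ℂ (MvPolynomial (Fin d) ℂ))
      (MvPolynomial.eval (fun k => (x k : ℂ))) (MvPolynomial.X k)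
    rw [Polynomial.aeval_def, this]
    simp only [MvPolynomial.eval_X, Polynomial.eval]
    congr 1
    ext <;> simp
  have h2 : ∑ j, (Pi.single k μ : Fin d → ℂ) j * (x j : ℂ) = μ * (x k : ℂ) := by
    rw [Finset.sum_eq_single k] <;> simp +contextual [Pi.single_apply]
  simp [h1, h2]

lemma exists_antideriv (p : Polynomial ℂ) : ∃ q : Polynomial ℂ, Polynomial.derivative q = p := by
  induction p using Polynomial.induction_on' with
  | add p q hp hq =>
    obtain ⟨a, rfl⟩ := hp
    obtain ⟨b, rfl⟩ := hq
    exact ⟨a + b, by simp⟩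
  | monomial n a =>
    refine ⟨Polynomial.monomial (n + 1) (a / (n + 1)), ?_⟩
    rw [Polynomial.derivative_monomial]
    have : (n : ℂ) + 1 ≠ 0 := by exact_mod_cast Nat.succ_ne_zero n
    simp [div_mul_cancel₀ _ this]

section
variable {E : Type*} [NormedAddCommGroup E] [NormedSpace ℂ E] [FiniteDimensional ℂ E]

lemma genEig (M : ℝ → (E →L[ℂ] E)) (B : E →L[ℂ] E) (hB : ∀ t, HasDerivAt M (M t * B) t)
    (μ : ℂ) (φ : E →L[ℂ] ℂ) (n : ℕ) : ∀ v : E,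
    (((B : E →ₗ[ℂ] E) - algebraMap ℂ (Module.End ℂ E) μ) ^ n) v = 0 →
    ∃ p : Polynomial ℂ, ∀ t : ℝ, φ (M t v) = p.eval (t : ℂ) * Complex.exp (μ * t) := by
  induction n with
  | zero =>
    intro v hv
    have : v = 0 := by simpa using hv
    exact ⟨0, fun t => by simp [this]⟩
  | succ n ih =>
    intro v hv
    obtain ⟨p, hp⟩ := ih (B v - μ • v) (by
      rw [pow_succ] at hv
      simpa [Module.algebraMap_end_apply] using hv)
    obtain ⟨q, hq⟩ := exists_antideriv p
    have hder : ∀ t : ℝ, HasDerivAt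
        (fun t : ℝ => φ (M t v) * Complex.exp (-(μ * t)) - q.eval (t : ℂ)) 0 t := by
      intro t
      have h1 : HasDerivAt (fun t => φ (M t v)) (φ (M t (B v))) t := by
        have h := (hB t)
        have hL := ((φ.comp (ContinuousLinearMap.apply ℂ E v)).restrictScalars ℝ).hasFDerivAt.comp_hasDerivAt t h
        exact hL
      have h2 : HasDerivAt (fun t : ℝ => Complex.exp (-(μ * t)))
          (Complex.exp (-(μ * t)) * (-(μ * 1))) t := by
        have : HasDerivAt (fun t : ℝ => -(μ * (t : ℂ))) (-(μ * 1)) t :=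
          ((HasDerivAt.ofReal_comp (hasDerivAt_id t)).const_mul μ).neg
        exact this.cexp
      have h3 : HasDerivAt (fun t : ℝ => q.eval (t : ℂ)) (p.eval (t : ℂ)) t := by
        have := (q.hasDerivAt (t : ℂ)).comp_ofReal
        rwa [hq] at this
      have h4 := (h1.mul h2).sub h3
      refine HasDerivAt.congr_deriv h4 ?_
      have h5 := hp t
      rw [map_sub, map_smul, map_sub, map_smul, smul_eq_mul] at h5
      have h6 : p.eval (t : ℂ) = (φ (M t (B v)) - μ * φ (M t v)) * Complex.exp (-(μ * t)) := by
        rw [h5, mul_assoc, ← Complex.exp_add]; simp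
      rw [h6]; ring
    have hconst := is_const_of_deriv_eq_zero (fun t => (hder t).differentiableAt)
      (fun t => (hder t).deriv)
    refine ⟨q + Polynomial.C (φ (M 0 v) * Complex.exp (-(μ * (0 : ℝ))) - q.eval ((0 : ℝ) : ℂ)),
      fun t => ?_⟩
    rw [Polynomial.eval_add, Polynomial.eval_C, ← hconst t 0]
    rw [add_sub_cancel, mul_assoc, ← Complex.exp_add]
    simp

lemma ep_oneVar {d : ℕ} (k : Fin d) (M : ℝ → (E →L[ℂ] E)) (hM : Continuous M) (h0 : M 0 = 1)
    (hadd : ∀ s t, M (s + t) = M s * M t) (φ : E →L[ℂ] ℂ) (v : E) :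
    IsEP d (fun x => φ (M (x k) v)) := by
  have : CompleteSpace E := FiniteDimensional.complete ℂ E
  obtain ⟨B, hB⟩ := oneParam M hM h0 hadd
  have hv : v ∈ ⨆ μ : ℂ, Module.End.maxGenEigenspace (B : E →ₗ[ℂ] E) μ := by
    rw [Module.End.iSup_maxGenEigenspace_eq_top]; trivial
  induction hv using Submodule.iSup_induction' with
  | mem μ v hv =>
    rw [Module.End.mem_maxGenEigenspace] at hv
    obtain ⟨n, hn⟩ := hv
    obtain ⟨p, hp⟩ := genEig M B hB μ φ n v (by
      rw [Algebra.algebraMap_eq_smul_one]; exact hn)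
    simp only [hp]
    exact IsEP.single k p μ
  | zero => simpa using IsEP.const 0
  | add a b _ _ ha hb =>
    simp only [map_add]
    exact ha.add hb

lemma ep_multi {d : ℕ} (M : (Fin d → ℝ) → (E →L[ℂ] E)) (hM : Continuous M) (h0 : M 0 = 1)
    (hadd : ∀ s t, M (s + t) = M s * M t) (S : Finset (Fin d)) : ∀ (φ : E →L[ℂ] ℂ) (v : E),
    IsEP d (fun x => φ (M (∑ k ∈ S, Pi.single k (x k)) v)) := by
  induction S using Finset.induction_on with
  | empty => intro φ v; simpa using IsEP.const _
  | insert k S hk ih =>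
    intro φ v
    let b := Module.finBasis ℂ E
    have e : ∀ x : Fin d → ℝ, φ (M (∑ j ∈ insert k S, Pi.single j (x j)) v)
        = ∑ i, φ (M (Pi.single k (x k)) (b i)) *
            (LinearMap.toContinuousLinearMap (b.coord i)) (M (∑ j ∈ S, Pi.single j (x j)) v) := by
      intro x
      rw [Finset.sum_insert hk, hadd, ContinuousLinearMap.mul_apply]
      generalize M (∑ j ∈ S, Pi.single j (x j)) v = w
      conv_lhs => rw [← b.sum_repr w]
      simp only [map_sum, map_smul, smul_eq_mul]
      exact Finset.sum_congr rfl fun i _ => mul_comm _ _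
    simp only [e]
    refine IsEP.sum _ fun i _ => IsEP.mul ?_ (ih _ v)
    refine ep_oneVar k (fun t => M (Pi.single k t)) ?_ ?_ ?_ φ (b i)
    · exact hM.comp (continuous_single (A := fun _ : Fin d => ℝ) k)
    · simpa using h0
    · intro s t; rw [Pi.single_add, hadd]

end

lemma ep_of_space {d : ℕ} (V : Submodule ℂ ((Fin d → ℝ) → ℂ)) (hfd : FiniteDimensional ℂ V)
    (hcont : ∀ g ∈ V, Continuous g) (htr : ∀ a, ∀ g ∈ V, tr a g ∈ V)
    (f : (Fin d → ℝ) → ℂ) (hf : f ∈ V) : IsEP d f := by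
  let e : V ≃ₗ[ℂ] (Fin (Module.finrank ℂ V) → ℂ) := (Module.finBasis ℂ V).equivFun
  have hec : Continuous e := LinearMap.continuous_of_finiteDimensional e.toLinearMap
  let T : (Fin d → ℝ) → (V →ₗ[ℂ] V) := fun a => (tr a).restrict (htr a)
  let M : (Fin d → ℝ) → ((Fin (Module.finrank ℂ V) → ℂ) →L[ℂ] (Fin (Module.finrank ℂ V) → ℂ)) :=
    fun a => LinearMap.toContinuousLinearMap (e.toLinearMap ∘ₗ T a ∘ₗ e.symm.toLinearMap)
  have hMa : ∀ a v, M a v = e (T a (e.symm v)) := fun a v => rfl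
  have hM : Continuous M := by
    rw [continuous_clm_apply]
    intro v
    simp only [hMa]
    refine hec.comp ?_
    refine Continuous.subtype_mk (f := fun a => tr a (e.symm v : (Fin d → ℝ) → ℂ)) ?_ _
    refine continuous_pi fun x => ?_
    have := hcont _ (e.symm v).2
    simp only [tr_apply]
    fun_prop
  have h0 : M 0 = 1 := by
    refine ContinuousLinearMap.ext fun v => ?_
    have : T 0 (e.symm v) = e.symm v := by
      apply Subtype.ext; funext x; simp [T, LinearMap.restrict_apply]
    rw [hMa, this]; simp
  have hadd : ∀ s t, M (s + t) = M s * M t := by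
    intro s t
    refine ContinuousLinearMap.ext fun v => ?_
    rw [ContinuousLinearMap.mul_apply, hMa, hMa, hMa, LinearEquiv.symm_apply_apply]
    congr 1
    apply Subtype.ext
    exact tr_add s t _
  let φ : (Fin (Module.finrank ℂ V) → ℂ) →L[ℂ] ℂ :=
    LinearMap.toContinuousLinearMap (LinearMap.proj 0 ∘ₗ V.subtype ∘ₗ e.symm.toLinearMap)
  have hφ : ∀ v, φ v = (e.symm v : (Fin d → ℝ) → ℂ) 0 := fun v => rfl
  have := ep_multi M hM h0 hadd Finset.univ φ (e ⟨f, hf⟩)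
  convert this using 1
  funext x
  rw [Finset.univ_sum_single, hφ, hMa]
  simp [T, LinearMap.restrict_apply]

end RadoMontel



/-- Montel-type theorem for Radó's functional equation: if `h 1, …, h s` span a dense
additive subgroup of `ℝ^d` and the continuous function `f` satisfies, for each `i`, that
`span {f, τ_{h i} f, …, (τ_{h i})^{n i} f}` has dimension at most `n i`, then `f` is an
exponential polynomial. -/
theorem stmt_0 (d s : ℕ) (h : Fin s → (Fin d → ℝ))
    (hdense : Dense ((AddSubgroup.closure (Set.range h) : AddSubgroup (Fin d → ℝ)) :
      Set (Fin d → ℝ)))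
    (f : (Fin d → ℝ) → ℂ) (hf : Continuous f)
    (hdim : ∀ i : Fin s, ∃ n : ℕ,
      Module.rank ℂ ↥(Submodule.span ℂ
        (Set.range fun k : Fin (n + 1) => fun x : Fin d → ℝ => f (x + (k : ℕ) • h i))) ≤ n) :
    ∃ (m : ℕ) (lam : Fin m → (Fin d → ℂ)) (P : Fin m → MvPolynomial (Fin d) ℂ),
      ∀ x : Fin d → ℝ,
        f x = ∑ j, (MvPolynomial.eval (fun k => (x k : ℂ)) (P j)) *
          Complex.exp (∑ k, lam j k * (x k : ℂ)) := by
  obtain ⟨V, hfd, hfV, hcont, htr⟩ := RadoMontel.exists_space h hdense f hf (fun i => by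
    obtain ⟨n, hn⟩ := hdim i
    exact RadoMontel.relation f (h i) n hn)
  obtain ⟨ι, _, lam, P, hP⟩ := RadoMontel.ep_of_space V hfd hcont htr f hfV
  let e := (Fintype.equivFin ι).symm
  refine ⟨Fintype.card ι, fun j => lam (e j), fun j => P (e j), fun x => ?_⟩
  rw [hP x]
  exact (e.sum_comp (fun j => (MvPolynomial.eval (fun k => (x k : ℂ)) (P j)) *
          Complex.exp (∑ k, lam j k * (x k : ℂ)))).symm
end

section
/- (Radó's theorem in higher dimensions.) Let U ⊆ ℝ^d be a nonempty open set, let n be a natural number, and let a_0, a_1, ..., a_n : U → ℝ be continuous functions such that the map a = (a_0, ..., a_n) does not vanish identically on U. Assume f : ℝ^d → ℝ is a continuous function satisfying a_0(h)f(x) + a_1(h)f(x + h) + ... + a_n(h)f(x + nh) = 0 for all x ∈ ℝ^d and all h ∈ U. Then f is an exponential polynomial in d variables, i.e., there are finitely many vectors λ_j ∈ ℂ^d and polynomials P_j ∈ ℂ[X_1,...,X_d] such that f(x) = Σ_j P_j(x)·exp(λ_j · x) for all x ∈ ℝ^d. -/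
open scoped BigOperators

namespace Rado

/-- The solution space of the one-dimensional equation. -/
def W (n : ℕ) (α β : ℝ) (c : ℕ → ℝ → ℂ) : Submodule ℂ (ℝ → ℂ) where
  carrier := {g | Continuous g ∧ ∀ x : ℝ, ∀ t ∈ Set.Icc α β,
    ∑ k ∈ Finset.range (n + 1), c k t * g (x + k * t) = 0}
  add_mem' := by
    rintro f g ⟨hf, hf'⟩ ⟨hg, hg'⟩
    refine ⟨hf.add hg, fun x t ht => ?_⟩
    simp only [Pi.add_apply, mul_add, Finset.sum_add_distrib, hf' x t ht, hg' x t ht, add_zero]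
  zero_mem' := ⟨continuous_const, fun x t ht => by simp⟩
  smul_mem' := by
    rintro a g ⟨hg, hg'⟩
    refine ⟨hg.const_smul a, fun x t ht => ?_⟩
    have := congrArg (fun z => a * z) (hg' x t ht)
    simp only [mul_zero, Finset.mul_sum] at this
    rw [← this]
    refine Finset.sum_congr rfl fun k _ => ?_
    simp only [Pi.smul_apply, smul_eq_mul]
    ring

/-- One-variable exponential polynomials. -/
def EP1 : Submodule ℂ (ℝ → ℂ) :=
  Submodule.span ℂ {g | ∃ (P : Polynomial ℂ) (l : ℂ),
    g = fun x : ℝ => P.eval (x : ℂ) * Complex.exp (l * x)}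

lemma extend_right {n : ℕ} {α β : ℝ} {c : ℕ → ℝ → ℂ} (hα : 0 < α) (hαβ : α < β)
    (hn : c n α ≠ 0) : ∃ C : ℝ, 1 ≤ C ∧ ∀ g ∈ W n α β c, ∀ M : ℝ,
      (∀ x ∈ Set.Icc 0 (n * α), ‖g x‖ ≤ M) → ∀ m : ℕ, ∀ x ∈ Set.Icc 0 ((n + m) * α),
        ‖g x‖ ≤ C ^ m * M := by
  refine ⟨1 + ∑ k ∈ Finset.range n, ‖c k α / c n α‖, ?_, ?_⟩
  · have : 0 ≤ ∑ k ∈ Finset.range n, ‖c k α / c n α‖ := Finset.sum_nonneg fun _ _ => norm_nonneg _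
    linarith
  set S := ∑ k ∈ Finset.range n, ‖c k α / c n α‖ with hS
  have hS0 : 0 ≤ S := Finset.sum_nonneg fun _ _ => norm_nonneg _
  intro g hg M hM m
  have hM0 : 0 ≤ M := (norm_nonneg _).trans (hM 0 ⟨le_rfl, by positivity⟩)
  induction m with
  | zero => simpa using hM
  | succ m ih =>
    intro x hx
    have hpow : 0 ≤ (1 + S) ^ m * M := by positivity
    by_cases hxm : x ≤ (n + m) * α
    · refine (ih x ⟨hx.1, hxm⟩).trans ?_
      rw [pow_succ]
      nlinarith [mul_nonneg hpow hS0]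
    · push Not at hxm
      have h := hg.2 (x - n * α) α ⟨le_rfl, hαβ.le⟩
      rw [Finset.sum_range_succ] at h
      have hx' : x - n * α + n * α = x := by ring
      rw [hx'] at h
      have hgx : g x = - ∑ k ∈ Finset.range n, c k α / c n α * g (x - n * α + k * α) := by
        have : c n α * g x = c n α * (- ∑ k ∈ Finset.range n, c k α / c n α * g (x - n * α + k * α)) := by
          rw [mul_neg, Finset.mul_sum, eq_neg_iff_add_eq_zero, add_comm, ← h]
          congr 1
          refine Finset.sum_congr rfl fun k _ => ?_
          field_simp
        exact mul_left_cancel₀ hn this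
      rw [hgx, norm_neg]
      calc _ ≤ ∑ k ∈ Finset.range n, ‖c k α / c n α‖ * ((1 + S) ^ m * M) := by
            refine norm_sum_le_of_le _ fun k hk => ?_
            rw [norm_mul]
            refine mul_le_mul_of_nonneg_left (ih _ ⟨?_, ?_⟩) (norm_nonneg _)
            · have : (0:ℝ) ≤ m * α := by positivity
              have : (0:ℝ) ≤ k * α := by positivity
              nlinarith
            · have hk' : (k:ℝ) + 1 ≤ n := by exact_mod_cast Finset.mem_range.1 hk
              have := hx.2
              push_cast at this
              nlinarith
        _ = S * ((1 + S) ^ m * M) := by rw [← Finset.sum_mul]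
        _ ≤ _ := by rw [pow_succ]; nlinarith

lemma extend_left {n : ℕ} {α β : ℝ} {c : ℕ → ℝ → ℂ} (hα : 0 < α) (hαβ : α < β)
    (h0 : c 0 α ≠ 0) {g : ℝ → ℂ} (hg : g ∈ W n α β c) (hz : ∀ x, 0 ≤ x → g x = 0) (x : ℝ) :
    g x = 0 := by
  have key : ∀ m : ℕ, ∀ x, -(m * α) ≤ x → g x = 0 := by
    intro m
    induction m with
    | zero => simpa using hz
    | succ m ih =>
      intro x hx
      have h := hg.2 x α ⟨le_rfl, hαβ.le⟩
      rw [Finset.sum_range_succ'] at h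
      rw [Finset.sum_eq_zero, zero_add] at h
      · simpa [h0] using h
      · intro k _
        rw [ih, mul_zero]
        have : (0:ℝ) ≤ k * α := by positivity
        push_cast at hx ⊢
        nlinarith
  obtain ⟨m, hm⟩ := exists_nat_ge (-x / α)
  refine key m x ?_
  rw [div_le_iff₀ hα] at hm
  linarith

lemma zero_of_zero {n : ℕ} {α β : ℝ} {c : ℕ → ℝ → ℂ} (hα : 0 < α) (hαβ : α < β)
    (h0 : c 0 α ≠ 0) (hn : c n α ≠ 0) {g : ℝ → ℂ} (hg : g ∈ W n α β c)
    (hz : ∀ x ∈ Set.Icc 0 (n * α), g x = 0) : g = 0 := by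
  funext x
  refine extend_left hα hαβ h0 hg (fun x hx => ?_) x
  obtain ⟨C, hC, h⟩ := extend_right hα hαβ hn
  obtain ⟨m, hm⟩ := exists_nat_ge (x / α)
  rw [div_le_iff₀ hα] at hm
  have := h g hg 0 (fun x hx => by simp [hz x hx]) m x ⟨hx, by
    have : (0:ℝ) ≤ n * α := by positivity
    linarith⟩
  simpa using this

lemma modulus {n : ℕ} {α β : ℝ} {c : ℕ → ℝ → ℂ} (hα : 0 < α) (hαβ : α < β)
    (hc : ∀ k ≤ n, ContinuousOn (c k) (Set.Icc α β))
    (h0 : ∀ t ∈ Set.Icc α β, c 0 t ≠ 0) (hn : c n α ≠ 0) :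
    ∃ δ > 0, ∀ g ∈ W n α β c, ∀ M : ℝ, (∀ x ∈ Set.Icc 0 (n * α), ‖g x‖ ≤ M) →
      ∀ x ∈ Set.Icc 0 (n * α), ∀ u ∈ Set.Icc 0 δ, ‖g (x + u) - g x‖ ≤ M / 2 := by
  have hβ : 0 < β := hα.trans hαβ
  obtain ⟨C, hC1, hC⟩ := extend_right hα hαβ hn
  set φ : ℝ → ℝ := fun t => max 0 ((t - α) * (β - t)) with hφ
  have hφc : Continuous φ := by fun_prop
  have hφ0 : ∀ t, t ∉ Set.Icc α β → φ t = 0 := by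
    intro t ht
    simp only [hφ, max_eq_left_iff]
    rw [Set.mem_Icc, not_and_or] at ht
    rcases ht with ht | ht <;> push Not at ht <;> nlinarith
  have hφs : HasCompactSupport φ := HasCompactSupport.intro isCompact_Icc hφ0
  set K : ℝ := ∫ t, φ t with hK
  have hKpos : 0 < K := by
    refine (hφc.integral_pos_of_hasCompactSupport_nonneg_nonzero hφs
      (fun t => le_max_left _ _) (x := (α + β) / 2) ?_)
    simp only [hφ]
    have : 0 < ((α + β) / 2 - α) * (β - (α + β) / 2) := by
      apply mul_pos <;> linarith
    exact (lt_max_of_lt_right this).ne'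
  set ψ : ℕ → ℝ → ℂ := fun k t =>
    (φ t : ℂ) * (c k (Set.projIcc α β hαβ.le t) / c 0 (Set.projIcc α β hαβ.le t)) with hψ
  have hψc : ∀ k ≤ n, Continuous (ψ k) := by
    intro k hk
    have h1 : ∀ k ≤ n, Continuous fun t => c k (Set.projIcc α β hαβ.le t) := fun k hk =>
      (hc k hk).comp_continuous (continuous_subtype_val.comp continuous_projIcc)
        (fun t => (Set.projIcc α β hαβ.le t).2)
    exact (Complex.continuous_ofReal.comp hφc).mul ((h1 k hk).div (h1 0 (Nat.zero_le _))
      (fun t => h0 _ (Set.projIcc α β hαβ.le t).2))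
  have hψ0 : ∀ k t, t ∉ Set.Icc α β → ψ k t = 0 := by
    intro k t ht
    simp [hψ, hφ0 t ht]
  have hψs : ∀ k, HasCompactSupport (ψ k) := fun k => HasCompactSupport.intro isCompact_Icc (hψ0 k)
  -- representation
  have rep : ∀ g ∈ W n α β c, ∀ x, (K : ℂ) * g x =
      - ∑ j ∈ Finset.range n, ∫ t, ψ (j+1) t * g (x + ((j+1 : ℕ) : ℝ) * t) := by
    intro g hg x
    rw [← MeasureTheory.integral_finsetSum, ← MeasureTheory.integral_neg, hK, ← integral_complex_ofReal,
      ← MeasureTheory.integral_mul_const]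
    · congr 1
      funext t
      by_cases ht : t ∈ Set.Icc α β
      · have h := hg.2 x t ht
        rw [Finset.sum_range_succ'] at h
        simp only [hψ, Set.projIcc_of_mem hαβ.le ht]
        have h00 := h0 t ht
        have : g x = - ∑ j ∈ Finset.range n, c (j+1) t / c 0 t * g (x + ((j+1 : ℕ):ℝ) * t) := by
          refine mul_left_cancel₀ h00 ?_
          rw [mul_neg, Finset.mul_sum, eq_neg_iff_add_eq_zero, add_comm, ← h]
          congr 1
          · refine Finset.sum_congr rfl fun k _ => ?_
            field_simp
          · simp
        rw [this, mul_neg, Finset.mul_sum]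
        congr 1
        refine Finset.sum_congr rfl fun k _ => ?_
        ring
      · simp [hψ0 _ t ht, hφ0 t ht]
    · intro j hj
      have hgc := hg.1
      exact ((hψc _ (Finset.mem_range.1 hj)).mul (by fun_prop)).integrable_of_hasCompactSupport
        ((hψs _).mul_right)
  obtain ⟨m, hm⟩ : ∃ m : ℕ, n * (α + β) ≤ m * α := by
    obtain ⟨m, hm⟩ := exists_nat_ge (n * (α + β) / α)
    exact ⟨m, (div_le_iff₀ hα).1 hm⟩
  set η : ℝ := K / (2 * ((n + 1) * (C ^ m * (α + β)))) with hη
  have hηpos : 0 < η := by positivity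
  have huc : ∃ δ > 0, ∀ j ∈ Finset.range n, ∀ s t : ℝ, |s - t| < δ → ‖ψ (j+1) s - ψ (j+1) t‖ ≤ η := by
    have h1 : ∀ᶠ δ in nhdsWithin (0:ℝ) (Set.Ioi 0), ∀ j ∈ Finset.range n, ∀ s t : ℝ, |s - t| < δ →
        ‖ψ (j+1) s - ψ (j+1) t‖ ≤ η := by
      rw [Filter.eventually_all_finset]
      intro j hj
      have := (hψs (j+1)).uniformContinuous_of_continuous (hψc (j+1) (Finset.mem_range.1 hj))
      rw [Metric.uniformContinuous_iff] at this
      obtain ⟨δ, hδ, h⟩ := this η hηpos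
      filter_upwards [Ioo_mem_nhdsGT hδ] with δ' hδ' s t hst
      have := h (a := s) (b := t) (by rw [Real.dist_eq]; exact hst.trans hδ'.2)
      rw [dist_eq_norm] at this
      exact this.le
    obtain ⟨δ, h, hδ⟩ := (h1.and self_mem_nhdsWithin).exists
    exact ⟨δ, hδ, h⟩
  obtain ⟨δ₀, hδ₀, huc⟩ := huc
  refine ⟨min α (δ₀ / 2), by positivity, ?_⟩
  intro g hg M hM x hx u hu
  have hM0 : 0 ≤ M := (norm_nonneg _).trans (hM 0 ⟨le_rfl, by positivity⟩)
  have hgc := hg.1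
  have hu1 : u ≤ α := hu.2.trans (min_le_left _ _)
  have hu2 : u < δ₀ := by linarith [hu.2.trans (min_le_right _ _)]
  have hdiff : (K : ℂ) * (g (x + u) - g x) = - ∑ j ∈ Finset.range n,
      ∫ t, (ψ (j+1) (t - u / ((j+1 : ℕ) : ℝ)) - ψ (j+1) t) * g (x + ((j+1 : ℕ) : ℝ) * t) := by
    rw [mul_sub, rep g hg, rep g hg, neg_sub_neg, ← neg_sub, ← Finset.sum_sub_distrib]
    congr 1
    refine Finset.sum_congr rfl fun j hj => ?_
    have e1 : ∫ t, ψ (j+1) t * g (x + u + ((j+1 : ℕ) : ℝ) * t) =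
        ∫ t, ψ (j+1) (t - u / ((j+1 : ℕ) : ℝ)) * g (x + ((j+1 : ℕ) : ℝ) * t) := by
      rw [← MeasureTheory.integral_sub_right_eq_self (fun t => ψ (j+1) t * g (x + u + ((j+1 : ℕ) : ℝ) * t))
        (u / ((j+1 : ℕ) : ℝ))]
      congr 1
      funext t
      congr 2
      have : ((j+1 : ℕ) : ℝ) ≠ 0 := by positivity
      field_simp
      ring
    have hc' := hψc _ (Finset.mem_range.1 hj)
    have i1 : MeasureTheory.Integrable fun t => ψ (j+1) t * g (x + ((j+1 : ℕ) : ℝ) * t) :=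
      (hc'.mul (by fun_prop)).integrable_of_hasCompactSupport ((hψs _).mul_right)
    have i2 : MeasureTheory.Integrable fun t => ψ (j+1) (t - u / ((j+1 : ℕ) : ℝ)) * g (x + ((j+1 : ℕ) : ℝ) * t) := by
      refine ((hc'.comp (continuous_id.sub continuous_const)).mul
        (by fun_prop)).integrable_of_hasCompactSupport (HasCompactSupport.mul_right ?_)
      exact (hψs (j+1)).comp_homeomorph (Homeomorph.subRight (u / ((j+1 : ℕ) : ℝ)))
    rw [e1, ← MeasureTheory.integral_sub i2 i1]
    simp only [sub_mul]
  have hbound : ∀ j ∈ Finset.range n, ‖∫ t, (ψ (j+1) (t - u / ((j+1 : ℕ) : ℝ)) - ψ (j+1) t) *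
      g (x + ((j+1 : ℕ) : ℝ) * t)‖ ≤ η * (C ^ m * M) * (α + β) := by
    intro j hj
    have hj1 : ((j+1 : ℕ) : ℝ) ≤ n := by exact_mod_cast Finset.mem_range.1 hj
    have hj0 : (1:ℝ) ≤ ((j+1 : ℕ) : ℝ) := by exact_mod_cast Nat.le_add_left 1 j
    have hq0 : 0 ≤ u / ((j+1 : ℕ) : ℝ) := div_nonneg hu.1 (by positivity)
    have hq1 : u / ((j+1 : ℕ) : ℝ) ≤ u := div_le_self hu.1 hj0
    rw [← MeasureTheory.setIntegral_eq_integral_of_forall_compl_eq_zero (s := Set.Icc 0 (α + β))]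
    · have := MeasureTheory.norm_setIntegral_le_of_norm_le_const (μ := MeasureTheory.volume)
        (s := Set.Icc 0 (α + β)) (C := η * (C ^ m * M)) (f := fun t => (ψ (j+1) (t - u / ((j+1 : ℕ) : ℝ)) - ψ (j+1) t) *
      g (x + ((j+1 : ℕ) : ℝ) * t)) (by simp) ?_
      · refine this.trans_eq ?_
        rw [Real.volume_real_Icc_of_le (by linarith)]
        ring
      · intro t ht
        rw [norm_mul]
        refine mul_le_mul (huc j hj _ _ ?_) (hC g hg M hM m _ ⟨?_, ?_⟩) (norm_nonneg _) hηpos.le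
        · rw [sub_sub_cancel_left, abs_neg, abs_of_nonneg hq0]
          linarith
        · have := mul_nonneg (by positivity : (0:ℝ) ≤ ((j+1 : ℕ) : ℝ)) ht.1
          linarith [hx.1]
        · have := mul_le_mul hj1 ht.2 ht.1 (by positivity)
          linarith [hx.2]
    · intro t ht
      rw [hψ0, hψ0]
      · simp
      · intro h
        exact ht ⟨hα.le.trans h.1, by linarith [h.2]⟩
      · intro h
        exact ht ⟨by linarith [h.1], by linarith [h.2]⟩
  have hfin : K * ‖g (x + u) - g x‖ ≤ n * (η * (C ^ m * M) * (α + β)) := by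
    have : ‖(K : ℂ) * (g (x + u) - g x)‖ = K * ‖g (x + u) - g x‖ := by
      rw [norm_mul, Complex.norm_real, Real.norm_of_nonneg hKpos.le]
    rw [← this, hdiff, norm_neg]
    refine (norm_sum_le_of_le _ hbound).trans_eq ?_
    simp
  have h2 : n * (η * (C ^ m * M) * (α + β)) ≤ K * (M / 2) := by
    have : (n + 1) * (η * (C ^ m * M) * (α + β)) = K * (M / 2) := by
      rw [hη]
      have : α + β ≠ 0 := by positivity
      field_simp
    rw [← this]
    have : 0 ≤ η * (C ^ m * M) * (α + β) := by positivity
    nlinarith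
  exact le_of_mul_le_mul_left (hfin.trans h2) hKpos

/-- If a sup bound always improves by a factor two, then `g` vanishes. -/
lemma zero_of_half {R : ℝ} {g : ℝ → ℂ} (hg : Continuous g)
    (h : ∀ M : ℝ, (∀ x ∈ Set.Icc 0 R, ‖g x‖ ≤ M) → ∀ x ∈ Set.Icc 0 R, ‖g x‖ ≤ M / 2) :
    ∀ x ∈ Set.Icc 0 R, g x = 0 := by
  intro x hx
  obtain ⟨y, hy, hmax⟩ := (isCompact_Icc (a := (0:ℝ)) (b := R)).exists_isMaxOn ⟨x, hx⟩
    hg.norm.continuousOn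
  have h1 := h ‖g y‖ (fun z hz => hmax hz) y hy
  have h2 : ‖g x‖ ≤ ‖g y‖ := hmax hx
  have h3 : ‖g y‖ ≤ 0 := by linarith
  exact norm_le_zero_iff.1 (h2.trans h3)

lemma poly_antideriv (P : Polynomial ℂ) : ∃ Q : Polynomial ℂ, Polynomial.derivative Q = P := by
  induction P using Polynomial.induction_on' with
  | add p q hp hq =>
    obtain ⟨a, rfl⟩ := hp
    obtain ⟨b, rfl⟩ := hq
    exact ⟨a + b, by simp⟩
  | monomial k a =>
    refine ⟨Polynomial.monomial (k+1) (a / (k+1)), ?_⟩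
    rw [Polynomial.derivative_monomial]
    have : (k:ℂ) + 1 ≠ 0 := by exact_mod_cast Nat.succ_ne_zero k
    simp [this]

lemma ode_step {g g1 : ℝ → ℂ} (l : ℂ) (P : Polynomial ℂ) (hg : ∀ x, HasDerivAt g (l * g x + g1 x) x)
    (h1 : g1 = fun x : ℝ => P.eval (x : ℂ) * Complex.exp (l * x)) :
    ∃ Q : Polynomial ℂ, g = fun x : ℝ => Q.eval (x : ℂ) * Complex.exp (l * x) := by
  obtain ⟨Q, hQ⟩ := poly_antideriv P
  have hd : ∀ x : ℝ, HasDerivAt (fun x : ℝ => g x * Complex.exp (-(l * x)) - Q.eval (x : ℂ)) 0 x := by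
    intro x
    have e1 : HasDerivAt (fun x : ℝ => Complex.exp (-(l * x))) (Complex.exp (-(l * x)) * (-(l * 1))) x :=
      ((((hasDerivAt_id (x:ℂ)).const_mul l).neg).cexp).comp_ofReal
    have e2 : HasDerivAt (fun x : ℝ => Q.eval (x : ℂ)) (P.eval (x : ℂ)) x := by
      rw [← hQ]
      exact (Q.hasDerivAt (x:ℂ)).comp_ofReal
    have e3 := ((hg x).mul e1).sub e2
    have e4 : (l * g x + g1 x) * Complex.exp (-(l * x)) + g x * (Complex.exp (-(l * x)) * (-(l * 1)))
        - P.eval (x : ℂ) = 0 := by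
      rw [h1, Complex.exp_neg]
      have := Complex.exp_ne_zero (l * x)
      field_simp
      ring
    rw [e4] at e3
    exact e3
  have hc := is_const_of_deriv_eq_zero (fun x => (hd x).differentiableAt) (fun x => (hd x).deriv)
  refine ⟨Q + Polynomial.C (g 0 * Complex.exp (-(l * (0:ℝ))) - Q.eval ((0:ℝ) : ℂ)), ?_⟩
  funext x
  have := hc x 0
  rw [Polynomial.eval_add, Polynomial.eval_C, ← this, Complex.exp_neg]
  have := Complex.exp_ne_zero (l * x)
  field_simp
  ring

lemma gen_eig {V : Submodule ℂ (ℝ → ℂ)} (D : Module.End ℂ V)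
    (hD : ∀ g : V, ∀ x, HasDerivAt (g : ℝ → ℂ) ((D g : ℝ → ℂ) x) x) (l : ℂ) (k : ℕ) :
    ∀ g : V, ((D - l • (1 : Module.End ℂ V)) ^ k) g = 0 →
    ∃ Q : Polynomial ℂ, (g : ℝ → ℂ) = fun x : ℝ => Q.eval (x : ℂ) * Complex.exp (l * x) := by
  induction k with
  | zero =>
    intro g hg
    refine ⟨0, ?_⟩
    have : g = 0 := by simpa using hg
    rw [this]
    funext x
    simp
  | succ k ih =>
    intro g hg
    rw [pow_succ, Module.End.mul_apply] at hg
    obtain ⟨P, hP⟩ := ih _ hg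
    refine ode_step l P (fun x => ?_) hP
    convert hD g x using 1
    simp

lemma all_ep {V : Submodule ℂ (ℝ → ℂ)} [FiniteDimensional ℂ V] (D : Module.End ℂ V)
    (hD : ∀ g : V, ∀ x, HasDerivAt (g : ℝ → ℂ) ((D g : ℝ → ℂ) x) x) (g : V) :
    (g : ℝ → ℂ) ∈ EP1 := by
  have hg : g ∈ ⨆ (μ : ℂ), D.maxGenEigenspace μ := by
    rw [Module.End.iSup_maxGenEigenspace_eq_top]; trivial
  refine Submodule.iSup_induction _ (motive := fun g : V => (g : ℝ → ℂ) ∈ EP1) hg ?_ ?_ ?_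
  · intro l x hx
    obtain ⟨k, hk⟩ := (Module.End.mem_maxGenEigenspace _ _ _).1 hx
    obtain ⟨Q, hQ⟩ := gen_eig D hD l k x hk
    exact Submodule.subset_span ⟨Q, l, hQ⟩
  · exact zero_mem _
  · intro x y hx hy
    exact add_mem hx hy

lemma W_shift {n : ℕ} {α β : ℝ} {c : ℕ → ℝ → ℂ} {g : ℝ → ℂ} (hg : g ∈ W n α β c) (s : ℝ) :
    (fun x => g (x + s)) ∈ W n α β c := by
  refine ⟨hg.1.comp (by fun_prop), fun x t ht => ?_⟩
  rw [← hg.2 (x + s) t ht]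
  refine Finset.sum_congr rfl fun k _ => ?_
  congr 2
  ring

lemma W_avg {n : ℕ} {α β : ℝ} {c : ℕ → ℝ → ℂ} {g : ℝ → ℂ} (hg : g ∈ W n α β c) (δ : ℝ) :
    (fun x => ∫ s in (0:ℝ)..δ, g (x + s)) ∈ W n α β c := by
  have hc := hg.1
  refine ⟨?_, fun x t ht => ?_⟩
  · exact intervalIntegral.continuous_parametric_intervalIntegral_of_continuous' (by fun_prop) _ _
  · simp only [← intervalIntegral.integral_const_mul]
    rw [← intervalIntegral.integral_finsetSum]
    · refine (intervalIntegral.integral_congr (g := fun _ => (0:ℂ)) fun s _ => ?_).trans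
        intervalIntegral.integral_zero
      simp only
      rw [← hg.2 (x + s) t ht]
      refine Finset.sum_congr rfl fun k _ => ?_
      congr 2
      ring
    · intro k _
      exact Continuous.intervalIntegrable (by fun_prop) _ _

lemma avg_deriv {g : ℝ → ℂ} (hg : Continuous g) (δ x : ℝ) :
    HasDerivAt (fun x => ∫ s in (0:ℝ)..δ, g (x + s)) (g (x + δ) - g x) x := by
  have h : (fun x => ∫ s in (0:ℝ)..δ, g (x + s)) =
      fun x => (∫ s in (0:ℝ)..(x + δ), g s) - ∫ s in (0:ℝ)..x, g s := by
    funext x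
    rw [intervalIntegral.integral_comp_add_left, add_zero,
      intervalIntegral.integral_interval_sub_left (hg.intervalIntegrable _ _)
        (hg.intervalIntegrable _ _)]
  rw [h]
  have h1 : ∀ y, HasDerivAt (fun x => ∫ s in (0:ℝ)..x, g s) (g y) y := fun y =>
    intervalIntegral.integral_hasDerivAt_right (hg.intervalIntegrable _ _)
      (hg.stronglyMeasurableAtFilter _ _) hg.continuousAt
  exact ((h1 (x + δ)).comp_add_const x δ).sub (h1 x)

lemma core {n : ℕ} {α β : ℝ} {c : ℕ → ℝ → ℂ} (hα : 0 < α) (hαβ : α < β)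
    (hc : ∀ k ≤ n, ContinuousOn (c k) (Set.Icc α β))
    (h0 : ∀ t ∈ Set.Icc α β, c 0 t ≠ 0) (hn : ∀ t ∈ Set.Icc α β, c n t ≠ 0) :
    ∃ (N : ℕ) (p : Fin N → ℝ) (e : Fin N → ℝ → ℂ), (∀ l, e l ∈ EP1) ∧
      ∀ g ∈ W n α β c, ∀ s, g s = ∑ l, g (p l) * e l s := by
  have hαm : α ∈ Set.Icc α β := ⟨le_rfl, hαβ.le⟩
  obtain ⟨δ, hδ, hmod⟩ := modulus hα hαβ hc h0 (hn α hαm)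
  have hzero : ∀ g ∈ W n α β c, (∀ M : ℝ, (∀ x ∈ Set.Icc 0 (n * α), ‖g x‖ ≤ M) →
      ∀ x ∈ Set.Icc 0 (n * α), ‖g x‖ ≤ M / 2) → g = 0 := fun g hg h =>
    zero_of_zero hα hαβ (h0 α hαm) (hn α hαm) hg (zero_of_half hg.1 h)
  set N : ℕ := ⌊n * α / δ⌋₊ + 1 with hN
  let p : Fin N → ℝ := fun l => (l : ℕ) * δ
  let E : W n α β c →ₗ[ℂ] (Fin N → ℂ) :=
    { toFun := fun g l => (g : ℝ → ℂ) (p l)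
      map_add' := fun g h => rfl
      map_smul' := fun a g => rfl }
  have hE : LinearMap.ker E = ⊥ := by
    rw [LinearMap.ker_eq_bot']
    rintro ⟨g, hg⟩ hEg
    refine Subtype.ext (hzero g hg fun M hM x hx => ?_)
    have hl : ⌊x / δ⌋₊ < N := Nat.lt_succ_of_le (Nat.floor_le_floor (by gcongr; exact hx.2))
    have h1 : g (⌊x / δ⌋₊ * δ) = 0 := congrFun hEg ⟨_, hl⟩
    have h2 : ⌊x / δ⌋₊ * δ ≤ x := (le_div_iff₀ hδ).1 (Nat.floor_le (div_nonneg hx.1 hδ.le))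
    have h3 : x < (⌊x / δ⌋₊ + 1) * δ := (div_lt_iff₀ hδ).1 (Nat.lt_floor_add_one _)
    have := hmod g hg M hM (⌊x / δ⌋₊ * δ) ⟨by positivity, h2.trans hx.2⟩ (x - ⌊x / δ⌋₊ * δ)
      ⟨by linarith, by linarith⟩
    simpa [h1] using this
  have : FiniteDimensional ℂ (W n α β c) :=
    FiniteDimensional.of_injective E (LinearMap.ker_eq_bot.1 hE)
  let A : W n α β c →ₗ[ℂ] W n α β c :=
    { toFun := fun g => ⟨_, W_avg g.2 δ⟩
      map_add' := fun g h => by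
        refine Subtype.ext ?_
        funext x
        have hg := g.2.1
        have hh := h.2.1
        exact intervalIntegral.integral_add (Continuous.intervalIntegrable (by fun_prop) _ _)
          (Continuous.intervalIntegrable (by fun_prop) _ _)
      map_smul' := fun a g => by
        refine Subtype.ext ?_
        funext x
        exact intervalIntegral.integral_const_mul _ _ }
  have hA : Function.Injective A := by
    rw [← LinearMap.ker_eq_bot, LinearMap.ker_eq_bot']
    rintro ⟨g, hg⟩ hAg
    refine Subtype.ext (hzero g hg fun M hM x hx => ?_)
    have hgc := hg.1
    have h1 : ∫ s in (0:ℝ)..δ, g (x + s) = 0 := congrFun (congrArg Subtype.val hAg) x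
    have h2 : ∫ s in (0:ℝ)..δ, (g (x + s) - g x) = - (δ * g x) := by
      rw [intervalIntegral.integral_sub (Continuous.intervalIntegrable (by fun_prop) _ _)
          (Continuous.intervalIntegrable (by fun_prop) _ _), h1, intervalIntegral.integral_const]
      simp
    have h3 : ‖∫ s in (0:ℝ)..δ, (g (x + s) - g x)‖ ≤ M / 2 * |δ - 0| := by
      refine intervalIntegral.norm_integral_le_of_norm_le_const fun s hs => ?_
      rw [Set.uIoc_of_le hδ.le] at hs
      exact hmod g hg M hM x hx s ⟨hs.1.le, hs.2⟩
    rw [h2, norm_neg, norm_mul, Complex.norm_real, Real.norm_of_nonneg hδ.le, sub_zero,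
      abs_of_pos hδ, mul_comm] at h3
    exact le_of_mul_le_mul_right h3 hδ
  let T : W n α β c →ₗ[ℂ] W n α β c :=
    { toFun := fun g => ⟨_, W_shift g.2 δ⟩
      map_add' := fun g h => rfl
      map_smul' := fun a g => rfl }
  let Ae := LinearEquiv.ofInjectiveEndo A hA
  let D : Module.End ℂ (W n α β c) := (T - 1) ∘ₗ Ae.symm.toLinearMap
  have hD : ∀ g : W n α β c, ∀ x, HasDerivAt (g : ℝ → ℂ) ((D g : ℝ → ℂ) x) x := by
    intro g x
    obtain ⟨g', rfl⟩ := Ae.surjective g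
    have : D (Ae g') = T g' - g' := by simp [D]
    rw [this]
    exact avg_deriv g'.2.1 δ x
  obtain ⟨L, hL⟩ := E.exists_leftInverse_of_injective hE
  refine ⟨N, p, fun l => (L (Pi.single l 1) : ℝ → ℂ), fun l => all_ep D hD _, fun g hg s => ?_⟩
  have h1 : L (E ⟨g, hg⟩) = ⟨g, hg⟩ := LinearMap.congr_fun hL _
  have h2 : E ⟨g, hg⟩ = ∑ l, g (p l) • (Pi.single l (1:ℂ) : Fin N → ℂ) := by
    funext i
    simp [E, Finset.sum_apply, Pi.single_apply]
  rw [h2, map_sum] at h1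
  have h3 := congrFun (congrArg Subtype.val h1) s
  simp only [map_smul] at h3
  rw [← h3]
  simp

lemma shrink {α β t : ℝ} {c : ℝ → ℂ} (hc : ContinuousOn c (Set.Icc α β)) (ht : t ∈ Set.Ioo α β)
    (h : c t ≠ 0) : ∃ α' β', α < α' ∧ α' < β' ∧ β' < β ∧ ∀ s ∈ Set.Icc α' β', c s ≠ 0 := by
  have h1 : ContinuousAt c t := hc.continuousAt (Icc_mem_nhds ht.1 ht.2)
  have h2 : {s | c s ≠ 0 ∧ s ∈ Set.Ioo α β} ∈ nhds t :=
    Filter.inter_mem (h1.eventually_ne h) (Ioo_mem_nhds ht.1 ht.2)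
  obtain ⟨ε, hε, hb⟩ := Metric.mem_nhds_iff.1 h2
  have h3 : ∀ s ∈ Set.Icc (t - ε/2) (t + ε/2), c s ≠ 0 ∧ s ∈ Set.Ioo α β := by
    intro s hs
    refine hb ?_
    rw [Metric.mem_ball, Real.dist_eq, abs_lt]
    constructor <;> linarith [hs.1, hs.2]
  exact ⟨t - ε/2, t + ε/2, (h3 _ ⟨le_rfl, by linarith⟩).2.1, by linarith,
    (h3 _ ⟨by linarith, le_rfl⟩).2.2, fun s hs => (h3 s hs).1⟩

lemma oneD {n : ℕ} {α β : ℝ} {c : ℕ → ℝ → ℂ} (hα : 0 < α)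
    (hc : ∀ k ≤ n, ContinuousOn (c k) (Set.Icc α β))
    (h : ∃ k ≤ n, ∃ t ∈ Set.Ioo α β, c k t ≠ 0) :
    ∃ (N : ℕ) (p : Fin N → ℝ) (e : Fin N → ℝ → ℂ), (∀ l, e l ∈ EP1) ∧
      ∀ g ∈ W n α β c, ∀ s, g s = ∑ l, g (p l) * e l s := by
  classical
  let Q : ℕ → Prop := fun k => k ≤ n ∧ ∃ t ∈ Set.Ioo α β, c k t ≠ 0
  obtain ⟨k0, hk0, ht0⟩ := h
  set N := Nat.findGreatest Q n with hN
  have hNQ : Q N := Nat.findGreatest_spec (P := Q) hk0 ⟨hk0, ht0⟩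
  have hNmax : ∀ k ≤ n, N < k → ∀ t ∈ Set.Ioo α β, c k t = 0 := by
    intro k hk hNk t ht
    by_contra hne
    exact Nat.findGreatest_is_greatest hNk hk ⟨hk, t, ht, hne⟩
  obtain ⟨hNn, t1, ht1, hct1⟩ := hNQ
  obtain ⟨α', β', h1, h2, h3, h4⟩ := shrink (hc N hNn) ht1 hct1
  have hex : ∃ k, ∃ t ∈ Set.Ioo α' β', c k t ≠ 0 :=
    ⟨N, (α' + β') / 2, ⟨by linarith, by linarith⟩, h4 _ ⟨by linarith, by linarith⟩⟩
  set M := Nat.find hex with hM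
  have hMN : M ≤ N := Nat.find_min' hex
    ⟨(α' + β') / 2, ⟨by linarith, by linarith⟩, h4 _ ⟨by linarith, by linarith⟩⟩
  have hMmin : ∀ k < M, ∀ t ∈ Set.Ioo α' β', c k t = 0 := by
    intro k hk t ht
    by_contra hne
    exact Nat.find_min hex hk ⟨t, ht, hne⟩
  obtain ⟨t2, ht2, hct2⟩ := Nat.find_spec hex
  obtain ⟨α'', β'', h5, h6, h7, h8⟩ := shrink
    ((hc M (hMN.trans hNn)).mono (Set.Icc_subset_Icc h1.le h3.le)) ht2 hct2
  obtain ⟨K, p, e, he, hrep⟩ := core (n := N - M) (α := α'') (β := β'') (c := fun k => c (M + k))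
    (by linarith) h6
    (fun k hk => (hc (M + k) (by omega)).mono
      (Set.Icc_subset_Icc (by linarith) (by linarith)))
    h8
    (fun t ht => by
      rw [Nat.add_sub_cancel' hMN]
      exact h4 t ⟨by linarith [ht.1], by linarith [ht.2]⟩)
  refine ⟨K, p, e, he, fun g hg => hrep g ⟨hg.1, fun x t ht => ?_⟩⟩
  have h9 := hg.2 (x - M * t) t ⟨by linarith [ht.1], by linarith [ht.2]⟩
  have hz1 : ∀ k < M, c k t = 0 := fun k hk =>
    hMmin k hk t ⟨by linarith [ht.1], by linarith [ht.2]⟩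
  have hz2 : ∀ k ≤ n, N < k → c k t = 0 := fun k hk hk' =>
    hNmax k hk hk' t ⟨by linarith [ht.1], by linarith [ht.2]⟩
  rw [← h9]
  have hsub : (Finset.range (N - M + 1)).map (addLeftEmbedding M) ⊆ Finset.range (n + 1) := by
    intro k hk
    simp only [Finset.mem_map, Finset.mem_range, addLeftEmbedding_apply] at hk ⊢
    omega
  rw [← Finset.sum_subset hsub, Finset.sum_map]
  · refine Finset.sum_congr rfl fun k _ => ?_
    simp only [addLeftEmbedding_apply]
    congr 2
    push_cast
    ring
  · intro k hk hk'
    simp only [Finset.mem_map, Finset.mem_range, addLeftEmbedding_apply] at hk hk'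
    have : c k t = 0 := by
      by_cases hkM : k < M
      · exact hz1 k hkM
      · refine hz2 k (by omega) ?_
        by_contra hkN
        exact hk' ⟨k - M, by omega, by omega⟩
    rw [this, zero_mul]

/-- Exponential polynomials on `ℝ^d`. -/
def IsEP (d : ℕ) (F : (Fin d → ℝ) → ℂ) : Prop :=
  ∃ (ι : Type) (_ : Fintype ι) (lam : ι → (Fin d → ℂ)) (P : ι → MvPolynomial (Fin d) ℂ),
      ∀ x : Fin d → ℝ,
        F x = ∑ j, (MvPolynomial.eval (fun k => (x k : ℂ)) (P j)) *
          Complex.exp (∑ k, lam j k * (x k : ℂ))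

lemma IsEP.add {d : ℕ} {F G : (Fin d → ℝ) → ℂ} (hF : IsEP d F) (hG : IsEP d G) :
    IsEP d (fun x => F x + G x) := by
  obtain ⟨ι, _, l, P, h⟩ := hF
  obtain ⟨κ, _, m, Q, h'⟩ := hG
  refine ⟨ι ⊕ κ, inferInstance, Sum.elim l m, Sum.elim P Q, fun x => ?_⟩
  beta_reduce
  rw [h, h', Fintype.sum_sum_type]
  simp

lemma IsEP.mul {d : ℕ} {F G : (Fin d → ℝ) → ℂ} (hF : IsEP d F) (hG : IsEP d G) :
    IsEP d (fun x => F x * G x) := by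
  obtain ⟨ι, _, l, P, h⟩ := hF
  obtain ⟨κ, _, m, Q, h'⟩ := hG
  refine ⟨ι × κ, inferInstance, fun i => l i.1 + m i.2, fun i => P i.1 * Q i.2, fun x => ?_⟩
  beta_reduce
  rw [h, h', Finset.sum_mul_sum, Fintype.sum_prod_type]
  refine Finset.sum_congr rfl fun i _ => Finset.sum_congr rfl fun j _ => ?_
  simp only [Pi.add_apply, add_mul, Finset.sum_add_distrib, Complex.exp_add, map_mul]
  ring

lemma IsEP.const {d : ℕ} (a : ℂ) : IsEP d (fun _ => a) :=
  ⟨Unit, inferInstance, fun _ => 0, fun _ => MvPolynomial.C a, fun x => by simp⟩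

lemma IsEP.sum {d : ℕ} {ι : Type*} (s : Finset ι) {F : ι → (Fin d → ℝ) → ℂ} (h : ∀ i, IsEP d (F i)) :
    IsEP d (fun x => ∑ i ∈ s, F i x) := by
  classical
  induction s using Finset.induction_on with
  | empty => simpa using IsEP.const 0
  | insert i s hi ih =>
    simp only [Finset.sum_insert hi]
    exact (h i).add ih

lemma IsEP.of_EP1 {d : ℕ} {e : ℝ → ℂ} (he : e ∈ EP1) (c : Fin d → ℝ) :
    IsEP d (fun x => e (∑ k, c k * x k)) := by
  refine Submodule.span_induction (p := fun e _ => IsEP d (fun x => e (∑ k, c k * x k)))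
    ?_ ?_ ?_ ?_ he
  · rintro _ ⟨P, l, rfl⟩
    refine ⟨Unit, inferInstance, fun _ k => l * c k,
      fun _ => Polynomial.aeval (∑ k, MvPolynomial.C (c k : ℂ) * MvPolynomial.X k) P, fun x => ?_⟩
    have h1 : ∀ q : MvPolynomial (Fin d) ℂ, MvPolynomial.eval (fun k => (x k : ℂ)) (Polynomial.aeval q P)
        = P.eval (MvPolynomial.eval (fun k => (x k : ℂ)) q) := by
      intro q
      have := Polynomial.aeval_algHom_apply (MvPolynomial.aeval (R := ℂ) (fun k => (x k : ℂ))) q P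
      simp only [MvPolynomial.aeval_eq_eval, Polynomial.aeval_def] at this ⊢
      rw [← Polynomial.eval₂_id]
      exact this.symm
    simp only [h1, Finset.univ_unique, Finset.sum_singleton]
    congr 2
    · simp
    · push_cast
      rw [Finset.mul_sum]
      exact Finset.sum_congr rfl fun k _ => by ring
  · exact IsEP.const 0
  · intro x y _ _ hx hy
    exact hx.add hy
  · intro a x _ hx
    exact (IsEP.const a).mul hx

lemma tensor {d : ℕ} (c : Fin d → Fin d → ℝ) (N : Fin d → ℕ) (p : ∀ i, Fin (N i) → ℝ)
    (e : ∀ i, Fin (N i) → ℝ → ℂ) (he : ∀ i l, e i l ∈ EP1) (S : Finset (Fin d)) :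
    ∀ F : (Fin d → ℝ) → ℂ,
      (∀ i ∈ S, ∀ y, ∀ s, F (Function.update y i s) =
        ∑ l, F (Function.update y i (p i l)) * e i l s) →
      (∀ y y', (∀ i ∈ S, y i = y' i) → F y = F y') →
      IsEP d (fun x => F (fun i => ∑ k, c i k * x k)) := by
  induction S using Finset.induction_on with
  | empty =>
    intro F _ h2
    have : (fun x : Fin d → ℝ => F (fun i => ∑ k, c i k * x k)) = fun _ => F 0 := by
      funext x
      exact h2 _ _ (by simp)
    rw [this]
    exact IsEP.const _
  | insert i S hi ih =>
    intro F h1 h2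
    have : (fun x : Fin d → ℝ => F (fun i => ∑ k, c i k * x k)) = fun x => ∑ l,
        (fun y => F (Function.update y i (p i l))) (fun i => ∑ k, c i k * x k) *
          e i l (∑ k, c i k * x k) := by
      funext x
      have := h1 i (Finset.mem_insert_self _ _) (fun i => ∑ k, c i k * x k) (∑ k, c i k * x k)
      rw [← this]
      congr 1
      exact (Function.update_eq_self i _).symm
    rw [this]
    refine IsEP.sum _ fun l => (ih (fun y => F (Function.update y i (p i l))) ?_ ?_).mul (IsEP.of_EP1 (he i l) (c i))
    · intro j hj y s
      have hij : j ≠ i := fun h => hi (h ▸ hj)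
      simp only [Function.update_comm hij]
      exact h1 j (Finset.mem_insert_of_mem hj) _ s
    · intro y y' hy
      refine h2 _ _ fun j hj => ?_
      by_cases hji : j = i
      · subst hji; simp
      · rw [Function.update_of_ne hji, Function.update_of_ne hji]
        exact hy j (Finset.mem_of_mem_insert_of_ne hj hji)

lemma exists_basis {d : ℕ} {V : Set (Fin d → ℝ)} (hV : IsOpen V) (hne : V.Nonempty) :
    ∃ b : Module.Basis (Fin d) ℝ (Fin d → ℝ), ∀ i, b i ∈ V := by
  have htop : Submodule.span ℝ V = ⊤ := by
    refine Submodule.eq_top_of_nonempty_interior' _ ?_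
    exact hne.mono (interior_maximal Submodule.subset_span hV)
  obtain ⟨s, hs, hspan, hli⟩ := exists_linearIndependent ℝ V
  let b := Module.Basis.mk hli (by rw [Subtype.range_coe, hspan, htop])
  let eqv := b.indexEquiv (Pi.basisFun ℝ (Fin d))
  refine ⟨b.reindex eqv, fun i => ?_⟩
  simp only [Module.Basis.reindex_apply, b, Module.Basis.mk_apply]
  exact hs (Subtype.coe_prop _)

end Rado

/-- Radó's theorem in higher dimensions: if a continuous `f : ℝ^d → ℝ` satisfies
`a₀(h) f(x) + a₁(h) f(x+h) + ⋯ + aₙ(h) f(x+nh) = 0` for all `x ∈ ℝ^d` and all `h` in a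
nonempty open set `U`, where the `aₖ` are continuous on `U` and `(a₀,…,aₙ)` does not vanish
identically on `U`, then `f` is an exponential polynomial in `d` variables. -/
theorem stmt_4 (d n : ℕ) (U : Set (Fin d → ℝ)) (hU : IsOpen U) (hUne : U.Nonempty)
    (a : Fin (n + 1) → (Fin d → ℝ) → ℝ) (ha : ∀ k, ContinuousOn (a k) U)
    (hnz : ∃ h ∈ U, ∃ k, a k h ≠ 0)
    (f : (Fin d → ℝ) → ℝ) (hf : Continuous f)
    (heq : ∀ x : Fin d → ℝ, ∀ h ∈ U, ∑ k : Fin (n + 1), a k h * f (x + (k : ℕ) • h) = 0) :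
    ∃ (m : ℕ) (lam : Fin m → (Fin d → ℂ)) (P : Fin m → MvPolynomial (Fin d) ℂ),
      ∀ x : Fin d → ℝ,
        (f x : ℂ) = ∑ j, (MvPolynomial.eval (fun k => (x k : ℂ)) (P j)) *
          Complex.exp (∑ k, lam j k * (x k : ℂ)) := by
  obtain ⟨h₀, hh₀, k₀, hk₀⟩ := hnz
  have hV : IsOpen (U ∩ a k₀ ⁻¹' {0}ᶜ) := (ha k₀).isOpen_inter_preimage hU isOpen_compl_singleton
  obtain ⟨b, hb⟩ := Rado.exists_basis hV ⟨h₀, hh₀, hk₀⟩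
  have key : ∀ i : Fin d, ∃ (N : ℕ) (p : Fin N → ℝ) (e : Fin N → ℝ → ℂ), (∀ l, e l ∈ Rado.EP1) ∧
      ∀ x, ∀ s : ℝ, ((f (x + s • b i) : ℝ) : ℂ) = ∑ l, ((f (x + p l • b i) : ℝ) : ℂ) * e l s := by
    intro i
    have hcont : Continuous fun t : ℝ => t • b i := by fun_prop
    have hmem : {t : ℝ | t • b i ∈ U ∧ 0 < t} ∈ nhds (1:ℝ) := by
      refine Filter.inter_mem (hcont.continuousAt (hU.mem_nhds ?_)) (Ioi_mem_nhds one_pos)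
      simpa using (hb i).1
    obtain ⟨ε, hε, hball⟩ := Metric.mem_nhds_iff.1 hmem
    have hI : ∀ t ∈ Set.Icc (1 - ε/2) (1 + ε/2), t • b i ∈ U ∧ 0 < t := by
      intro t ht
      refine hball ?_
      rw [Metric.mem_ball, Real.dist_eq, abs_lt]
      constructor <;> linarith [ht.1, ht.2]
    let c : ℕ → ℝ → ℂ := fun k t => if hk : k < n + 1 then ((a ⟨k, hk⟩ (t • b i) : ℝ) : ℂ) else 0
    obtain ⟨N, p, e, he, hrep⟩ := Rado.oneD (n := n) (α := 1 - ε/2) (β := 1 + ε/2) (c := c)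
      (hI _ ⟨le_rfl, by linarith⟩).2
      (fun k hk => by
        have hk' : k < n + 1 := by omega
        simp only [c, hk', dif_pos]
        exact Complex.continuous_ofReal.comp_continuousOn
          ((ha _).comp hcont.continuousOn fun t ht => (hI t ht).1))
      ⟨k₀, by omega, 1, ⟨by linarith, by linarith⟩, by
        have := (hb i).2
        have hle : (k₀ : ℕ) ≤ n := by omega
        simpa [c, hle] using this⟩
    refine ⟨N, p, e, he, fun x => hrep (fun s => ((f (x + s • b i) : ℝ) : ℂ)) ⟨by fun_prop, ?_⟩⟩
    intro s t ht
    rw [Finset.sum_range]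
    have := heq (x + s • b i) (t • b i) (hI t ht).1
    have h2 := congrArg (fun r : ℝ => (r : ℂ)) this
    simp only [Complex.ofReal_sum, Complex.ofReal_mul, Complex.ofReal_zero] at h2
    rw [← h2]
    refine Finset.sum_congr rfl fun k _ => ?_
    simp only [c, k.2, dif_pos]
    congr 3
    rw [← Nat.cast_smul_eq_nsmul ℝ]
    module
  choose N p e he hrep using key
  have hupd : ∀ (y : Fin d → ℝ) (i : Fin d) (s : ℝ),
      ∑ j, Function.update y i s j • b j = (∑ j ∈ Finset.univ.erase i, y j • b j) + s • b i := by
    intro y i s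
    rw [← Finset.sum_erase_add _ _ (Finset.mem_univ i), Function.update_self]
    congr 1
    refine Finset.sum_congr rfl fun j hj => ?_
    rw [Function.update_of_ne (Finset.ne_of_mem_erase hj)]
  have hEP := Rado.tensor (fun i k => b.repr (Pi.single k 1) i) N p e he Finset.univ
    (fun y => ((f (∑ j, y j • b j) : ℝ) : ℂ))
    (fun i _ y s => by
      simp only [hupd]
      exact hrep i _ s)
    (fun y y' h => by
      have : y = y' := funext fun i => h i (Finset.mem_univ i)
      rw [this])
  obtain ⟨ι, _, lam, P, h⟩ := hEP
  let q := Fintype.equivFin ι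
  refine ⟨Fintype.card ι, fun j => lam (q.symm j), fun j => P (q.symm j), fun x => ?_⟩
  rw [q.symm.sum_comp (fun j => (MvPolynomial.eval (fun k => (x k : ℂ)) (P j)) *
          Complex.exp (∑ k, lam j k * (x k : ℂ))), ← h x]
  congr 2
  conv_lhs => rw [← b.sum_repr x]
  refine Finset.sum_congr rfl fun i _ => ?_
  congr 1
  conv_lhs => rw [← (Pi.basisFun ℝ (Fin d)).sum_repr x]
  simp [mul_comm]
end

section
/- Let n be a natural number and let f : ℝ → ℝ be a continuous function which satisfies the Popoviciu–Ionescu functional equation of order n: for all x, h ∈ ℝ, the determinant of the (n+1)×(n+1) matrix whose (i, j) entry is f(x + (i + j)h), for 0 ≤ i, j ≤ n, equals zero. Then f is an exponential polynomial, i.e., there are finitely many scalars λ_j ∈ ℂ and polynomials P_j ∈ ℂ[X] such that f(x) = Σ_j P_j(x)·exp(λ_j x) for all x ∈ ℝ. -/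
/-- The Hankel matrix of size `n+1` at offset `m` of the sequence `b` is singular. -/
def HankelSing (b : ℤ → ℝ) (n : ℕ) (m : ℤ) : Prop :=
  ∃ c : ℕ → ℝ, (∃ j ≤ n, c j ≠ 0) ∧
    ∀ i ≤ n, ∑ j ∈ Finset.range (n + 1), c j * b (m + (i : ℕ) + (j : ℕ)) = 0

theorem not_sing {b : ℤ → ℝ} {n : ℕ} {m : ℤ} (h : ¬ HankelSing b n m) (c : ℕ → ℝ)
    (hc : ∀ i ≤ n, ∑ j ∈ Finset.range (n + 1), c j * b (m + (i : ℕ) + (j : ℕ)) = 0) :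
    ∀ j ≤ n, c j = 0 := by
  by_contra! h2
  exact h ⟨c, h2, hc⟩

theorem key_rel {b : ℤ → ℝ} {n : ℕ} {m : ℤ} (h : ¬ HankelSing b n m)
    (h1 : HankelSing b (n + 1) (m - 1)) :
    ∃ c : ℕ → ℝ, c 0 ≠ 0 ∧ c (n + 1) = 1 ∧
      ∀ i ≤ n + 1, ∑ j ∈ Finset.range (n + 2), c j * b (m - 1 + (i : ℕ) + (j : ℕ)) = 0 := by
  obtain ⟨c, ⟨j0, hj0, hne⟩, hc⟩ := h1
  have c0 : c 0 ≠ 0 := by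
    intro h0
    have := not_sing h (fun j => c (j + 1)) (fun i hi => by
      have := hc i (by omega)
      rw [Finset.sum_range_succ'] at this
      simp only [h0, zero_mul, add_zero] at this
      rw [← this]
      refine Finset.sum_congr rfl fun j _ => ?_
      congr 2
      push_cast
      ring)
    rcases j0 with _ | j
    · exact hne h0
    · exact hne (this j (by omega))
  have cn : c (n + 1) ≠ 0 := by
    intro h0
    have := not_sing h c (fun i hi => by
      have := hc (i + 1) (by omega)
      rw [Finset.sum_range_succ] at this
      simp only [h0, zero_mul, add_zero] at this
      rw [← this]
      refine Finset.sum_congr rfl fun j _ => ?_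
      congr 2
      push_cast
      ring)
    exact c0 (this 0 (by omega))
  refine ⟨fun j => (c (n + 1))⁻¹ * c j, by simp [c0, cn], by simp [cn], fun i hi => ?_⟩
  simp only [mul_assoc]
  rw [← Finset.mul_sum, hc i hi, mul_zero]

theorem sing_up {b : ℤ → ℝ} {n : ℕ} {m : ℤ} (h : ¬ HankelSing b n m)
    (h1 : HankelSing b (n + 1) (m - 1)) : ¬ HankelSing b n (m + 1) := by
  obtain ⟨c, c0, cn, hc⟩ := key_rel h h1
  rintro ⟨e, ⟨j0, hj0, hne⟩, he⟩
  -- combine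
  set e' : ℕ → ℝ := fun j => (if j = 0 then 0 else e (j - 1)) with he'
  have hz := not_sing h (fun j => e' j - e n * c j) (fun i hi => by
    have h2 := hc (i + 1) (by omega)
    have h3 := he i hi
    have h4 : ∑ j ∈ Finset.range (n + 2), e' j * b (m + (i : ℕ) + (j : ℕ)) = 0 := by
      rw [Finset.sum_range_succ', ← h3]
      simp only [he', if_true, zero_mul, add_zero]
      refine Finset.sum_congr rfl fun j _ => ?_
      simp only [Nat.add_eq_zero_iff, one_ne_zero, and_false, if_false, Nat.add_sub_cancel]
      congr 2
      push_cast
      ring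
    have h5 : ∑ j ∈ Finset.range (n + 2), c j * b (m + (i : ℕ) + (j : ℕ)) = 0 := by
      rw [← h2]
      refine Finset.sum_congr rfl fun j _ => ?_
      congr 2
      push_cast
      ring
    have h6 : ∑ j ∈ Finset.range (n + 2), (e' j - e n * c j) * b (m + (i : ℕ) + (j : ℕ)) = 0 := by
      simp only [sub_mul, mul_assoc]
      rw [Finset.sum_sub_distrib, ← Finset.mul_sum, h4, h5]
      simp
    rw [Finset.sum_range_succ] at h6
    simpa [cn, he'] using h6)
  have hen : e n = 0 := by
    have := hz 0 (by omega)
    simp only [he', if_true, zero_sub, neg_eq_zero, mul_eq_zero] at this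
    tauto
  by_cases hjn : j0 = n
  · exact hne (hjn ▸ hen)
  · have := hz (j0 + 1) (by omega)
    simp [he', hen] at this
    exact hne this

theorem sing_down {b : ℤ → ℝ} {n : ℕ} {m : ℤ} (h : ¬ HankelSing b n m)
    (h1 : HankelSing b (n + 1) (m - 1)) : ¬ HankelSing b n (m - 1) := by
  obtain ⟨c, c0, cn, hc⟩ := key_rel h h1
  rintro ⟨e, ⟨j0, hj0, hne⟩, he⟩
  set e' : ℕ → ℝ := fun j => (if j = n + 1 then 0 else e j) with he'
  have hz := not_sing h (fun j => e' (j + 1) - e 0 / c 0 * c (j + 1)) (fun i hi => by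
    have h2 := hc i (by omega)
    have h3 := he i hi
    have h4 : ∑ j ∈ Finset.range (n + 2), e' j * b (m - 1 + (i : ℕ) + (j : ℕ)) = 0 := by
      rw [Finset.sum_range_succ, ← h3]
      simp only [he', if_true, zero_mul, add_zero]
      refine Finset.sum_congr rfl fun j hj => ?_
      rw [if_neg (by have := Finset.mem_range.1 hj; omega)]
    have h6 : ∑ j ∈ Finset.range (n + 2), (e' j - e 0 / c 0 * c j) *
        b (m - 1 + (i : ℕ) + (j : ℕ)) = 0 := by
      simp only [sub_mul, mul_assoc]
      rw [Finset.sum_sub_distrib, ← Finset.mul_sum, h4, h2]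
      simp
    rw [Finset.sum_range_succ'] at h6
    have h7 : e' 0 - e 0 / c 0 * c 0 = 0 := by
      simp [he', c0]
    rw [h7, zero_mul, add_zero] at h6
    rw [← h6]
    refine Finset.sum_congr rfl fun j _ => ?_
    congr 2
    push_cast
    ring)
  have hen : e 0 = 0 := by
    have := hz n le_rfl
    simp only [he', if_true, cn, zero_sub, neg_eq_zero, mul_one, div_eq_zero_iff] at this
    tauto
  rcases j0 with _ | j
  · exact hne hen
  · have := hz j (by omega)
    simp only [he', hen, zero_div, zero_mul, sub_zero] at this
    rw [if_neg (by omega)] at this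
    exact hne this

theorem exists_rec (b : ℤ → ℝ) (n : ℕ) (h : ∀ m, HankelSing b n m) :
    ∃ d ≤ n, ∃ c : ℕ → ℝ, c 0 ≠ 0 ∧ c d = 1 ∧
      ∀ k : ℤ, ∑ j ∈ Finset.range (d + 1), c j * b (k + (j : ℕ)) = 0 := by
  induction n with
  | zero =>
    refine ⟨0, le_rfl, fun _ => 1, one_ne_zero, rfl, fun k => ?_⟩
    obtain ⟨c, ⟨j, hj, hne⟩, hc⟩ := h k
    obtain rfl : j = 0 := by omega
    have := hc 0 le_rfl
    simp [hne] at this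
    simpa using this
  | succ n ih =>
    by_cases hall : ∀ m, HankelSing b n m
    · obtain ⟨d, hd, r⟩ := ih hall
      exact ⟨d, by omega, r⟩
    push Not at hall
    obtain ⟨m0, hm0⟩ := hall
    have hns : ∀ m, ¬ HankelSing b n m := by
      intro m
      induction m using Int.inductionOn' (b := m0) with
      | zero => exact hm0
      | succ k _ ihk => exact sing_up ihk (h _)
      | pred k _ ihk => exact sing_down ihk (h _)
    choose c c0 cn hc using fun m => key_rel (hns m) (h (m - 1))
    have hstep : ∀ m, ∀ j ≤ n + 1, c m j = c (m + 1) j := by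
      intro m j hj
      have := not_sing (hns m) (fun j => c m j - c (m + 1) j) (fun i hi => by
        have h2 := hc m (i + 1) (by omega)
        have h3 := hc (m + 1) i (by omega)
        have : ∑ j ∈ Finset.range (n + 2), (c m j - c (m + 1) j) *
            b (m + (i : ℕ) + (j : ℕ)) = 0 := by
          simp only [sub_mul]
          rw [Finset.sum_sub_distrib, sub_eq_zero]
          trans 0
          · rw [← h2]
            refine Finset.sum_congr rfl fun j _ => ?_
            congr 2
            push_cast
            ring
          · rw [← h3]
            refine Finset.sum_congr rfl fun j _ => ?_
            congr 2
            push_cast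
            ring
        rw [Finset.sum_range_succ] at this
        simpa [cn] using this)
      by_cases hj' : j = n + 1
      · rw [hj', cn, cn]
      · exact sub_eq_zero.1 (this j (by omega))
    have hconst : ∀ m, ∀ j ≤ n + 1, c m j = c 0 j := by
      intro m
      induction m using Int.induction_on with
      | zero => intros; rfl
      | succ k ihk => intro j hj; rw [← hstep _ j hj, ihk j hj]
      | pred k ihk =>
        intro j hj
        rw [hstep _ j hj, ← ihk j hj]
        congr 1
        ring
    refine ⟨n + 1, le_rfl, c 0, c0 0, cn 0, fun k => ?_⟩
    have := hc (k + 1) 0 (by omega)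
    rw [← this]
    refine Finset.sum_congr rfl fun j hj => ?_
    rw [hconst (k + 1) j (by have := Finset.mem_range.1 hj; omega)]
    congr 2
    push_cast
    ring

theorem rec_zero (u : ℤ → ℝ) (d : ℕ) (c : ℕ → ℝ) (c0 : c 0 ≠ 0) (cd : c d = 1)
    (hc : ∀ k : ℤ, ∑ j ∈ Finset.range (d + 1), c j * u (k + (j : ℕ)) = 0)
    (hu : ∀ i < d, u (i : ℕ) = 0) : ∀ k, u k = 0 := by
  have key : ∀ k : ℤ, ∀ i < d, u (k + (i : ℕ)) = 0 := by
    intro k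
    induction k using Int.induction_on with
    | zero => simpa using hu
    | succ k ih =>
      intro i hi
      by_cases h : i + 1 < d
      · rw [← ih (i + 1) h]
        congr 1
        push_cast
        ring
      · have h2 := hc k
        rw [Finset.sum_range_succ, Finset.sum_eq_zero] at h2
        · rw [cd] at h2
          obtain rfl : d = i + 1 := by omega
          rw [zero_add, one_mul] at h2
          rw [← h2]
          congr 1
          push_cast
          ring
        · intro j hj
          rw [ih j (Finset.mem_range.1 hj), mul_zero]
    | pred k ih =>
      intro i hi
      rcases i with _ | i
      · have h2 := hc (-(k : ℤ) - 1)
        rw [Finset.sum_range_succ', Finset.sum_eq_zero] at h2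
        · simpa [c0] using h2
        · intro j hj
          rw [mul_eq_zero]
          right
          rw [← ih j (Finset.mem_range.1 hj)]
          congr 1
          push_cast
          ring
      · rw [← ih i (by omega)]
        congr 1
        push_cast
        ring
  intro k
  rcases d with _ | d
  · have := hc k
    simpa [c0] using this
  · simpa using key k 0 (by omega)

theorem int_det (b : ℤ → ℝ) (n : ℕ) (h : ∀ m, HankelSing b n m) (s t : Fin (n + 1) → ℤ) :
    Matrix.det (Matrix.of fun i j => b (s i + t j)) = 0 := by
  obtain ⟨d, hd, c, c0, cd, hc⟩ := exists_rec b n h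
  let A : Matrix (Fin d) (Fin (n + 1)) ℝ := Matrix.of fun i j => b ((i : ℕ) + t j)
  have hk : LinearMap.ker A.mulVecLin ≠ ⊥ :=
    LinearMap.ker_ne_bot_of_finrank_lt (by simp; omega)
  obtain ⟨e, he, hne⟩ := Submodule.exists_mem_ne_zero_of_ne_bot hk
  rw [← Matrix.exists_mulVec_eq_zero_iff]
  refine ⟨e, hne, ?_⟩
  have hz := rec_zero (fun k => ∑ j, b (k + t j) * e j) d c c0 cd (fun k => by
    simp only [Finset.mul_sum]
    rw [Finset.sum_comm]
    refine Finset.sum_eq_zero fun i _ => ?_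
    have := hc (k + t i)
    simp only [← mul_assoc]
    rw [← Finset.sum_mul]
    rw [mul_eq_zero]
    left
    rw [← this]
    refine Finset.sum_congr rfl fun j _ => ?_
    congr 2
    ring) (fun i hi => by
      have := congrFun (LinearMap.mem_ker.1 he) ⟨i, hi⟩
      simpa [A, Matrix.mulVec, dotProduct] using this)
  ext i
  simpa [Matrix.mulVec, dotProduct] using hz (s i)

theorem real_det (n : ℕ) (f : ℝ → ℝ) (hf : Continuous f)
    (heq : ∀ x h : ℝ,
      Matrix.det (Matrix.of fun i j : Fin (n + 1) => f (x + ((i : ℕ) + (j : ℕ)) * h)) = 0)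
    (x y : Fin (n + 1) → ℝ) : Matrix.det (Matrix.of fun i j => f (x i + y j)) = 0 := by
  have hint : ∀ δ : ℝ, ∀ s t : Fin (n + 1) → ℤ,
      Matrix.det (Matrix.of fun i j => f ((s i : ℝ) * δ + t j * δ)) = 0 := by
    intro δ s t
    have := int_det (fun k => f (k * δ)) n (fun m => by
      obtain ⟨v, hv, hv2⟩ := Matrix.exists_mulVec_eq_zero_iff.2 (heq (m * δ) δ)
      refine ⟨fun j => if h : j < n + 1 then v ⟨j, h⟩ else 0, ?_, ?_⟩
      · obtain ⟨j, hj⟩ := Function.ne_iff.1 hv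
        refine ⟨j, by omega, ?_⟩
        simp only [j.2, dif_pos]
        exact hj
      · intro i hi
        have := congrFun hv2 ⟨i, by omega⟩
        rw [Finset.sum_range]
        simp only [Matrix.mulVec, dotProduct, Matrix.of_apply, Pi.zero_apply] at this
        rw [← this]
        refine Finset.sum_congr rfl fun j _ => ?_
        simp only [Fin.is_lt, dif_pos, Fin.eta]
        rw [mul_comm]
        congr 2
        push_cast
        ring) s t
    rw [← this]
    congr 1
    ext i j
    simp only [Matrix.of_apply]
    congr 1
    push_cast
    ring
  have hlim : ∀ a : ℝ, Filter.Tendsto (fun N : ℕ => (⌊a * (N + 1)⌋ : ℝ) * ((N : ℝ) + 1)⁻¹)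
      Filter.atTop (nhds a) := by
    intro a
    rw [tendsto_iff_norm_sub_tendsto_zero]
    refine squeeze_zero (fun _ => norm_nonneg _) (fun N => ?_)
      (tendsto_one_div_add_atTop_nhds_zero_nat (𝕜 := ℝ))
    have hN : (0 : ℝ) < N + 1 := by positivity
    have e : (⌊a * (N + 1)⌋ : ℝ) * ((N : ℝ) + 1)⁻¹ - a
        = ((⌊a * (N + 1)⌋ : ℝ) - a * (N + 1)) / (N + 1) := by
      field_simp
    rw [e, Real.norm_eq_abs, abs_div, abs_of_pos hN]
    gcongr
    rw [abs_le]
    have := Int.floor_le (a * (N + 1))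
    have := Int.lt_floor_add_one (a * (N + 1))
    constructor <;> linarith
  have hcont : Continuous fun M : Matrix (Fin (n + 1)) (Fin (n + 1)) ℝ => M.det :=
    Continuous.matrix_det continuous_id
  have hM : Filter.Tendsto (fun N : ℕ => (Matrix.of fun i j : Fin (n + 1) =>
      f ((⌊x i * (N + 1)⌋ : ℝ) * ((N : ℝ) + 1)⁻¹ + (⌊y j * (N + 1)⌋ : ℝ) * ((N : ℝ) + 1)⁻¹)))
      Filter.atTop (nhds (Matrix.of fun i j => f (x i + y j))) := by
    refine tendsto_pi_nhds.2 fun i => tendsto_pi_nhds.2 fun j => ?_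
    exact (hf.tendsto _).comp ((hlim _).add (hlim _))
  have := (hcont.tendsto _).comp hM
  refine tendsto_nhds_unique this ?_
  refine tendsto_const_nhds.congr fun N => ?_
  exact (hint _ (fun i => ⌊x i * (N + 1)⌋) (fun j => ⌊y j * (N + 1)⌋)).symm

/-- exponential polynomial -/
def IsEP (g : ℝ → ℂ) : Prop := ∃ (m : ℕ) (lam : Fin m → ℂ) (P : Fin m → Polynomial ℂ),
      ∀ x : ℝ, g x = ∑ j, (P j).eval (x : ℂ) * Complex.exp (lam j * x)

theorem IsEP.zero : IsEP (fun _ => 0) := ⟨0, Fin.elim0, Fin.elim0, by simp⟩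

theorem IsEP.add {g h : ℝ → ℂ} (hg : IsEP g) (hh : IsEP h) : IsEP (fun x => g x + h x) := by
  obtain ⟨m, l, P, e⟩ := hg
  obtain ⟨m', l', P', e'⟩ := hh
  refine ⟨m + m', Fin.append l l', Fin.append P P', fun x => ?_⟩
  rw [Fin.sum_univ_add]
  simp [e, e']

theorem antider (p : Polynomial ℂ) : ∃ q : Polynomial ℂ, q.derivative = p := by
  induction p using Polynomial.induction_on' with
  | add p q hp hq =>
    obtain ⟨a, rfl⟩ := hp
    obtain ⟨b, rfl⟩ := hq
    exact ⟨a + b, by simp⟩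
  | monomial n a =>
    refine ⟨Polynomial.monomial (n + 1) (a / (n + 1)), ?_⟩
    rw [Polynomial.derivative_monomial]
    have : (n : ℂ) + 1 ≠ 0 := by exact_mod_cast Nat.succ_ne_zero n
    congr 1
    push_cast
    field_simp

/-- gen eigenvectors -/
theorem genEig {V : Type*} [AddCommGroup V] [Module ℂ V] (A : Module.End ℂ V) (φ : ℝ → V →ₗ[ℂ] ℂ)
    (hφ : ∀ v t, HasDerivAt (fun t => φ t v) (φ t (A v)) t) (lam : ℂ) (k : ℕ) :
    ∀ v, ((A - algebraMap ℂ (Module.End ℂ V) lam) ^ k) v = 0 →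
      ∃ p : Polynomial ℂ, ∀ t : ℝ, φ t v = p.eval (t : ℂ) * Complex.exp (lam * t) := by
  induction k with
  | zero =>
    intro v hv
    have : v = 0 := by simpa using hv
    exact ⟨0, by simp [this]⟩
  | succ k ih =>
    intro v hv
    rw [pow_succ, Module.End.mul_apply] at hv
    obtain ⟨p, hp⟩ := ih _ hv
    obtain ⟨q, hq⟩ := antider p
    have hd : ∀ t : ℝ, HasDerivAt
        (fun t : ℝ => φ t v * Complex.exp (-(lam * t)) - q.eval (t : ℂ)) 0 t := by
      intro t
      have h1 : HasDerivAt (fun t : ℝ => Complex.exp (-(lam * t)))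
          (Complex.exp (-(lam * t)) * (-(lam * 1))) t :=
        (((Complex.ofRealCLM.hasDerivAt (x := t)).const_mul lam).neg).cexp
      have h2 : HasDerivAt (fun t : ℝ => q.eval (t : ℂ)) (p.eval (t : ℂ)) t := by
        have := (q.hasDerivAt (t : ℂ)).comp_ofReal
        rwa [hq] at this
      have h3 := ((hφ v t).mul h1).sub h2
      refine h3.congr_deriv ?_
      have h4 := hp t
      simp only [LinearMap.sub_apply, Module.algebraMap_end_apply, map_sub, map_smul,
        smul_eq_mul] at h4
      have h5 : Complex.exp (lam * t) * Complex.exp (-(lam * t)) = 1 := by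
        rw [← Complex.exp_add]; simp
      linear_combination (Complex.exp (-(lam * t))) * h4 + p.eval (t : ℂ) * h5
    have hconst := is_const_of_deriv_eq_zero (fun t => (hd t).differentiableAt)
      (fun t => (hd t).deriv)
    refine ⟨q + Polynomial.C (φ 0 v * Complex.exp (-(lam * (0 : ℝ))) - q.eval ((0 : ℝ) : ℂ)),
      fun t => ?_⟩
    rw [← hconst t 0]
    simp only [Polynomial.eval_add, Polynomial.eval_C]
    have h5 : Complex.exp (-(lam * t)) * Complex.exp (lam * t) = 1 := by
      rw [← Complex.exp_add]; simp
    linear_combination (-φ t v) * h5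

theorem allEP {V : Type*} [AddCommGroup V] [Module ℂ V] [FiniteDimensional ℂ V]
    (A : Module.End ℂ V) (φ : ℝ → V →ₗ[ℂ] ℂ)
    (hφ : ∀ v t, HasDerivAt (fun t => φ t v) (φ t (A v)) t) (v : V) : IsEP (fun t => φ t v) := by
  have hv : v ∈ ⨆ μ : ℂ, A.maxGenEigenspace μ := by
    rw [Module.End.iSup_maxGenEigenspace_eq_top]; trivial
  induction hv using Submodule.iSup_induction' with
  | mem μ v hv =>
    obtain ⟨k, hk⟩ := (Module.End.mem_maxGenEigenspace A μ v).1 hv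
    obtain ⟨p, hp⟩ := genEig A φ hφ μ k v (by
      rw [← hk, Algebra.algebraMap_eq_smul_one])
    exact ⟨1, fun _ => μ, fun _ => p, by simpa using hp⟩
  | zero => simpa using IsEP.zero
  | add x y _ _ hx hy => simpa using hx.add hy

theorem semigroup_deriv {R : Type*} [NormedRing R] [NormedAlgebra ℝ R] [CompleteSpace R]
    (T : ℝ → R) (hT : Continuous T) (h0 : T 0 = 1) (hadd : ∀ s t, T (s + t) = T s * T t) :
    ∃ A : R, ∀ t, HasDerivAt T (T t * A) t := by
  let F : ℝ → R := fun x => ∫ s in (0 : ℝ)..x, T s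
  have hF : ∀ x, HasDerivAt F (T x) x := fun x => hT.integral_hasStrictDerivAt 0 x |>.hasDerivAt
  have hlim := (hasDerivAt_iff_tendsto_slope_zero.1 (hF 0))
  rw [h0] at hlim
  have hopen : ∀ᶠ r in nhds (1 : R), IsUnit r := Units.isOpen.mem_nhds (isUnit_one)
  obtain ⟨ε, hu, hε⟩ := ((hlim.eventually hopen).and self_mem_nhdsWithin).exists
  have hε0 : ε ≠ 0 := hε
  have hF0 : F 0 = 0 := by simp [F]
  rw [zero_add, hF0, sub_zero] at hu
  have hS : ∀ t, T t * F ε = F (t + ε) - F t := by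
    intro t
    simp only [F]
    rw [intervalIntegral.integral_interval_sub_left (hT.intervalIntegrable _ _)
      (hT.intervalIntegrable _ _)]
    have := intervalIntegral.integral_comp_add_left (a := 0) (b := ε) T t
    rw [add_zero] at this
    rw [← this]
    simp only [hadd]
    exact ((ContinuousLinearMap.mul ℝ R (T t)).intervalIntegral_comp_comm
      (hT.intervalIntegrable 0 ε)).symm
  obtain ⟨u, hu⟩ := hu
  have hT' : ∀ t, T t = (F (t + ε) - F t) * (ε⁻¹ • (↑u⁻¹ : R)) := by
    intro t
    rw [← hS, mul_assoc, mul_smul_comm, ← smul_mul_assoc, ← hu]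
    simp
  have hd : HasDerivAt T ((T (0 + ε) - T 0) * (ε⁻¹ • (↑u⁻¹ : R))) 0 := by
    have h1 : HasDerivAt (fun t => F (t + ε)) (T (0 + ε)) 0 :=
      (hF (0 + ε)).comp_add_const 0 ε
    have := (h1.sub (hF 0)).mul_const (ε⁻¹ • (↑u⁻¹ : R))
    exact this.congr_of_eventuallyEq (Filter.Eventually.of_forall hT')
  refine ⟨(T (0 + ε) - T 0) * (ε⁻¹ • (↑u⁻¹ : R)), fun t => ?_⟩
  have h2 : HasDerivAt T ((T (0 + ε) - T 0) * (ε⁻¹ • (↑u⁻¹ : R))) (t + -t) := by rw [add_neg_cancel]; exact hd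
  have h3 := (h2.comp_add_const t (-t)).const_mul (T t)
  refine h3.congr_of_eventuallyEq (Filter.Eventually.of_forall fun s => ?_)
  show T s = T t * T (s + -t)
  rw [← hadd]
  congr 1
  ring

theorem bordered (f : ℝ → ℝ) (r : ℕ) (x y : Fin r → ℝ)
    (hxy : Matrix.det (Matrix.of fun i j => f (x i + y j)) ≠ 0)
    (hall : ∀ x y : Fin (r + 1) → ℝ, Matrix.det (Matrix.of fun i j => f (x i + y j)) = 0)
    (a b : ℝ) :
    f (a + b) = ∑ k, ∑ l, f (a + y k) *
      (Matrix.of fun i j => f (x i + y j))⁻¹ k l * f (x l + b) := by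
  set M : Matrix (Fin r) (Fin r) ℝ := Matrix.of fun i j => f (x i + y j) with hM
  have hun : IsUnit M.det := isUnit_iff_ne_zero.2 hxy
  let e : Fin r ⊕ Fin 1 ≃ Fin (r + 1) := finSumFinEquiv
  let B : Matrix (Fin r) (Fin 1) ℝ := Matrix.of fun l _ => f (x l + b)
  let C : Matrix (Fin 1) (Fin r) ℝ := Matrix.of fun _ k => f (a + y k)
  let D : Matrix (Fin 1) (Fin 1) ℝ := Matrix.of fun _ _ => f (a + b)
  have h := hall (Sum.elim x (fun _ => a) ∘ e.symm) (Sum.elim y (fun _ => b) ∘ e.symm)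
  rw [← Matrix.det_submatrix_equiv_self e] at h
  have h2 : (Matrix.of fun i j => f ((Sum.elim x (fun _ => a) ∘ e.symm) i +
      (Sum.elim y (fun _ => b) ∘ e.symm) j)).submatrix e e = Matrix.fromBlocks M B C D := by
    ext i j
    rcases i with i | i <;> rcases j with j | j <;> simp [M, B, C, D]
  rw [h2] at h
  let _ := Matrix.invertibleOfIsUnitDet M hun
  rw [Matrix.det_fromBlocks₁₁, mul_eq_zero, or_iff_right hxy, Matrix.det_fin_one,
    Matrix.sub_apply, sub_eq_zero, Matrix.invOf_eq_nonsing_inv] at h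
  have h3 : f (a + b) = (C * M⁻¹ * B) 0 0 := h
  rw [h3]
  simp only [Matrix.mul_apply, Finset.sum_mul, B, C, Matrix.of_apply]
  rw [Finset.sum_comm]

section
attribute [local instance] Matrix.linftyOpNormedRing Matrix.linftyOpNormedAlgebra

theorem final (f : ℝ → ℝ) (hf : Continuous f) (r : ℕ) (x y : Fin r → ℝ)
    (hxy : Matrix.det (Matrix.of fun i j => f (x i + y j)) ≠ 0)
    (hall : ∀ x y : Fin (r + 1) → ℝ, Matrix.det (Matrix.of fun i j => f (x i + y j)) = 0) :
    IsEP (fun t => (f t : ℂ)) := by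
  have key := bordered f r x y hxy hall
  set M : Matrix (Fin r) (Fin r) ℝ := Matrix.of fun i j => f (x i + y j) with hM
  have hun : IsUnit M.det := isUnit_iff_ne_zero.2 hxy
  let N : ℝ → Matrix (Fin r) (Fin r) ℝ := fun t => Matrix.of fun i j => f (x i + t + y j)
  have hN0 : N 0 = M := by ext i j; simp [N, M]
  have hN : ∀ s t, N (s + t) = N s * M⁻¹ * N t := by
    intro s t
    ext i j
    have := key (x i + s) (t + y j)
    simp only [Matrix.mul_apply, N, Matrix.of_apply, Finset.sum_mul]
    rw [Finset.sum_comm]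
    simp only [← add_assoc] at this ⊢
    exact this
  have hNc : Continuous N := by
    refine continuous_matrix fun i j => ?_
    simp only [N, Matrix.of_apply]
    fun_prop
  let T : ℝ → Matrix (Fin r) (Fin r) ℂ := fun t => (M⁻¹ * N t).map Complex.ofReal
  have hTc : Continuous T := by
    have : Continuous fun t => M⁻¹ * N t := continuous_const.matrix_mul hNc
    exact this.matrix_map Complex.continuous_ofReal
  obtain ⟨A, hA⟩ := semigroup_deriv T hTc
    (by simp only [T, hN0, Matrix.nonsing_inv_mul M hun]
        exact Matrix.map_one _ (by simp) (by simp))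
    (fun s t => by
      simp only [T, hN]
      have := Matrix.map_mul (L := M⁻¹ * N s) (M := M⁻¹ * N t) (f := Complex.ofRealHom)
      simp only [Matrix.mul_assoc] at this ⊢
      exact this)
  let u : Fin r → ℂ := fun k => (f (y k) : ℂ)
  let v : Fin r → ℂ := fun k => ((M⁻¹.mulVec fun l => f (x l)) k : ℝ)
  let L : Matrix (Fin r) (Fin r) ℂ →ₗ[ℂ] (Fin r → ℂ) →ₗ[ℂ] ℂ :=
    LinearMap.mk₂ ℂ (fun B w => u ⬝ᵥ B.mulVec w)
      (by intros; simp [Matrix.add_mulVec]) (by intros; simp [Matrix.smul_mulVec])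
      (by intros; simp [Matrix.mulVec_add]) (by intros; simp [Matrix.mulVec_smul])
  have hEP := allEP (Matrix.mulVecLin A) (fun t => L (T t)) (fun w t => by
    let L' : Matrix (Fin r) (Fin r) ℂ →L[ℝ] ℂ :=
      LinearMap.toContinuousLinearMap ((L.flip w).restrictScalars ℝ)
    have := L'.hasFDerivAt.comp_hasDerivAt t (hA t)
    refine this.congr_deriv ?_
    simp only [L', L, LinearMap.mk₂_apply, Matrix.mulVecLin_apply, Matrix.mulVec_mulVec]
    rfl) v
  convert hEP using 2 with t
  have h1 := key 0 t
  simp only [zero_add] at h1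
  have h2 : ∀ l, f (x l + t) = (N t).mulVec (M⁻¹.mulVec fun l => f (x l)) l := by
    intro l
    have := key (x l + t) 0
    rw [add_zero] at this
    rw [this]
    simp only [Matrix.mulVec, dotProduct, N, Matrix.of_apply, Finset.mul_sum, mul_assoc, add_zero]
  have h3 : f t = (fun k => f (y k)) ⬝ᵥ (M⁻¹ * N t).mulVec (M⁻¹.mulVec fun l => f (x l)) := by
    rw [h1, ← Matrix.mulVec_mulVec]
    simp only [h2]
    generalize (N t).mulVec (M⁻¹.mulVec fun l => f (x l)) = w
    simp only [dotProduct, Matrix.mulVec, Finset.mul_sum, mul_assoc]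
  rw [h3]
  simp only [L, LinearMap.mk₂_apply, T, u, v, dotProduct, Matrix.mulVec, Matrix.map_apply]
  push_cast
  rfl
end

theorem ep_of_det (n : ℕ) (f : ℝ → ℝ) (hf : Continuous f)
    (hdet : ∀ x y : Fin (n + 1) → ℝ, Matrix.det (Matrix.of fun i j => f (x i + y j)) = 0) :
    IsEP (fun t => (f t : ℂ)) := by
  induction n with
  | zero =>
    exact final f hf 0 Fin.elim0 Fin.elim0 (by simp) hdet
  | succ n ih =>
    by_cases h : ∀ x y : Fin (n + 1) → ℝ, Matrix.det (Matrix.of fun i j => f (x i + y j)) = 0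
    · exact ih h
    · push Not at h
      obtain ⟨x, y, hxy⟩ := h
      exact final f hf _ x y hxy hdet

/-- Every continuous solution `f : ℝ → ℝ` of the Popoviciu–Ionescu functional equation
`det [f(x + (i+j)h)]_{0 ≤ i,j ≤ n} = 0` (for all `x, h ∈ ℝ`) is an exponential polynomial. -/
theorem stmt_5 (n : ℕ) (f : ℝ → ℝ) (hf : Continuous f)
    (heq : ∀ x h : ℝ,
      Matrix.det (Matrix.of fun i j : Fin (n + 1) => f (x + ((i : ℕ) + (j : ℕ)) * h)) = 0) :
    ∃ (m : ℕ) (lam : Fin m → ℂ) (P : Fin m → Polynomial ℂ),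
      ∀ x : ℝ, (f x : ℂ) = ∑ j, (P j).eval (x : ℂ) * Complex.exp (lam j * x) := by
  exact ep_of_det n f hf (real_det n f hf heq)
end

section
/- Let n be a natural number and assume f : ℝ^d → ℂ is a continuous function satisfying the Popoviciu–Ionescu functional equation of order n in ℝ^d: for all x, h ∈ ℝ^d, det[f(x + (i + j)h)]_{0 ≤ i, j ≤ n} = 0. Suppose moreover there exist T_1, ..., T_d > 0 such that for every k ∈ {1, ..., d} and every point (a_1, ..., a_{k-1}, a_{k+1}, ..., a_d) ∈ ℝ^{d-1}, the one-variable function x_k ↦ f(a_1, ..., a_{k-1}, x_k, a_{k+1}, ..., a_d) is T_k-periodic. Then there exist a finite set F ⊂ ℤ^d and coefficients c_α ∈ ℂ (α ∈ F) such that f(x_1, ..., x_d) = Σ_{α ∈ F} c_α · exp(2πi(α_1 x_1/T_1 + ... + α_d x_d/T_d)) for all (x_1, ..., x_d) ∈ ℝ^d. -/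
open scoped BigOperators

section PIhelpers
open Polynomial

/-- The value of the shifted functional attached to `a` on the polynomial `p`. -/
noncomputable def piS (a : ℤ → ℂ) (p : ℂ[X]) (m : ℤ) : ℂ := p.sum fun k c => c * a (m + k)

lemma piS_add (a : ℤ → ℂ) (p q : ℂ[X]) (m : ℤ) : piS a (p + q) m = piS a p m + piS a q m := by
  unfold piS
  exact Polynomial.sum_add_index p q _ (fun k => by simp) (fun k b c => by ring)

lemma piS_C_mul (a : ℤ → ℂ) (c : ℂ) (p : ℂ[X]) (m : ℤ) :
    piS a (C c * p) m = c * piS a p m := by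
  induction p using Polynomial.induction_on' with
  | add p q hp hq => rw [mul_add, piS_add, piS_add, hp, hq, mul_add]
  | monomial k b =>
    unfold piS
    rw [C_mul_monomial, sum_monomial_index _ _ (by simp), sum_monomial_index _ _ (by simp),
      mul_assoc]

lemma piS_sub (a : ℤ → ℂ) (p q : ℂ[X]) (m : ℤ) : piS a (p - q) m = piS a p m - piS a q m := by
  have : p - q = p + C (-1) * q := by simp [sub_eq_add_neg]
  rw [this, piS_add, piS_C_mul]
  ring

lemma piS_X_mul (a : ℤ → ℂ) (p : ℂ[X]) (m : ℤ) : piS a (X * p) m = piS a p (m + 1) := by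
  induction p using Polynomial.induction_on' with
  | add p q hp hq =>
    rw [mul_add, piS_add, piS_add, hp, hq]
  | monomial k c =>
    unfold piS
    rw [X_mul_monomial, sum_monomial_index _ _ (by simp), sum_monomial_index _ _ (by simp)]
    congr 2
    push_cast
    ring

/-- The Hankel form of size `n` at `m` is degenerate. -/
def piE (a : ℤ → ℂ) (n : ℕ) (m : ℤ) : Prop :=
  ∃ p : ℂ[X], p ≠ 0 ∧ p.degree < n ∧ ∀ i : ℕ, i < n → piS a p (m + i) = 0

lemma deg_drop {p : ℂ[X]} {n : ℕ} (h : p.degree < ((n + 1 : ℕ) : WithBot ℕ)) (h0 : p.coeff n = 0) :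
    p.degree < n := by
  rw [Polynomial.degree_lt_iff_coeff_zero] at *
  intro m hm
  rcases hm.eq_or_lt with rfl | h1
  · exact h0
  · exact h m h1

lemma deg_X_mul {p : ℂ[X]} {n : ℕ} (h : p.degree < n) :
    (X * p).degree < ((n + 1 : ℕ) : WithBot ℕ) := by
  rw [Polynomial.degree_lt_iff_coeff_zero] at *
  intro m hm
  obtain ⟨m, rfl⟩ : ∃ k, m = k + 1 := ⟨m - 1, by omega⟩
  rw [coeff_X_mul]
  exact h m (by omega)

lemma deg_of_X_mul {p : ℂ[X]} {n : ℕ} (h : (X * p).degree < ((n + 1 : ℕ) : WithBot ℕ)) :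
    p.degree < n := by
  rw [Polynomial.degree_lt_iff_coeff_zero] at *
  intro m hm
  have := h (m + 1) (by omega)
  rwa [coeff_X_mul] at this

lemma deg_comb {p q : ℂ[X]} {n : ℕ} (c : ℂ) (hp : p.degree < n) (hq : q.degree < n) :
    (p - C c * q).degree < n := by
  rw [Polynomial.degree_lt_iff_coeff_zero] at *
  intro m hm
  simp [hp m hm, hq m hm]

lemma prop_of {a : ℤ → ℂ} {n : ℕ} {m : ℤ} (hN : ¬ piE a n m) {p q : ℂ[X]}
    (hp : p.degree < ((n + 1 : ℕ) : WithBot ℕ)) (hq : q.degree < ((n + 1 : ℕ) : WithBot ℕ)) (hq0 : q ≠ 0)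
    (kp : ∀ i : ℕ, i < n → piS a p (m + i) = 0) (kq : ∀ i : ℕ, i < n → piS a q (m + i) = 0) :
    q.coeff n ≠ 0 ∧ p = C (p.coeff n / q.coeff n) * q := by
  have h1 : q.coeff n ≠ 0 := fun h => hN ⟨q, hq0, deg_drop hq h, kq⟩
  refine ⟨h1, ?_⟩
  by_contra hne
  refine hN ⟨p - C (p.coeff n / q.coeff n) * q, sub_ne_zero.2 hne, ?_, ?_⟩
  · apply deg_drop (deg_comb _ hp hq)
    simp [h1]
  · intro i hi
    rw [piS_sub, piS_C_mul, kp i hi, kq i hi]; simp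

lemma core {a : ℤ → ℂ} {n : ℕ} (hE : ∀ m, piE a (n + 1) m) {m : ℤ} (hN : ¬ piE a n m)
    {p : ℂ[X]} (hp : p.degree < ((n + 1 : ℕ) : WithBot ℕ)) (hp0 : p ≠ 0)
    (kp : ∀ i : ℕ, i < n → piS a p (m + i) = 0) :
    p.coeff 0 ≠ 0 ∧ piS a p (m - 1) = 0 ∧ piS a p (m + n) = 0 ∧ ¬ piE a n (m + 1) ∧
      ¬ piE a n (m - 1) := by
  obtain ⟨q, hq0, hq, kq⟩ := hE (m - 1)
  have kq' : ∀ i : ℕ, i < n → piS a q (m + i) = 0 := by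
    intro i hi
    have := kq (i + 1) (by omega)
    push_cast at this
    rwa [show m - 1 + ((i : ℤ) + 1) = m + i by ring] at this
  obtain ⟨r, hr0, hr, kr⟩ := hE m
  obtain ⟨hqn, hpq⟩ := prop_of hN hp hq hq0 kp kq'
  obtain ⟨hrn, hpr⟩ := prop_of hN hp hr hr0 kp (fun i hi => kr i (by omega))
  have hpn := (prop_of hN hp hp hp0 kp kp).1
  have hback : piS a p (m - 1) = 0 := by
    rw [hpq, piS_C_mul]
    have := kq 0 (by omega)
    simp at this
    simp [this]
  have hfwd : piS a p (m + n) = 0 := by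
    rw [hpr, piS_C_mul, kr n (by omega), mul_zero]
  have kpb : ∀ i : ℕ, i < n → piS a p (m - 1 + i) = 0 := by
    intro i hi
    rcases i with _ | i
    · simpa using hback
    · push_cast
      rw [show m - 1 + ((i : ℤ) + 1) = m + i by ring]
      exact kp i (by omega)
  have fac : ∀ w : ℂ[X], w.coeff 0 = 0 → ∃ v, w = X * v := fun w h => X_dvd_iff.2 h
  have h0 : p.coeff 0 ≠ 0 := by
    intro h
    obtain ⟨v, rfl⟩ := fac p h
    refine hN ⟨v, right_ne_zero_of_mul hp0, deg_of_X_mul hp, fun i hi => ?_⟩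
    have := kpb i hi
    rw [piS_X_mul] at this
    rwa [show m - 1 + (i : ℤ) + 1 = m + i by ring] at this
  refine ⟨h0, hback, hfwd, ?_, ?_⟩
  · rintro ⟨w, hw0, hw, kw⟩
    obtain ⟨-, h⟩ := prop_of hN (deg_X_mul hw) hp hp0 (fun i hi => by
      have := kw i hi
      rw [piS_X_mul]
      rwa [show m + (i : ℤ) + 1 = m + 1 + i by ring]) kp
    set t := (X * w).coeff n / p.coeff n
    have h2 := congrArg (fun z => z.coeff 0) h
    simp [h0] at h2
    rw [h2] at h
    simp [hw0] at h
  · rintro ⟨w, hw0, hw, kw⟩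
    obtain ⟨v, hv⟩ := fac (w - C (w.coeff 0 / p.coeff 0) * p) (by simp [h0])
    have hw' : w.degree < ((n + 1 : ℕ) : WithBot ℕ) := hw.trans (by exact_mod_cast Nat.lt_succ_self n)
    have hv0 : v = 0 := by
      by_contra hv0
      refine hN ⟨v, hv0, deg_of_X_mul (hv ▸ deg_comb _ hw' hp), fun i hi => ?_⟩
      have : piS a (X * v) (m - 1 + i) = 0 := by
        rw [← hv, piS_sub, piS_C_mul, kw i hi, kpb i hi]; simp
      rw [piS_X_mul] at this
      rwa [show m - 1 + (i : ℤ) + 1 = m + i by ring] at this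
    rw [hv0, mul_zero, sub_eq_zero] at hv
    have h2 := congrArg (fun z => z.coeff n) hv
    have h3 : w.coeff n = 0 := (Polynomial.degree_lt_iff_coeff_zero w n).1 hw n le_rfl
    simp only [coeff_C_mul, h3] at h2
    have h4 : w.coeff 0 / p.coeff 0 = 0 := by
      by_contra h
      exact (mul_ne_zero h hpn) h2.symm
    rw [h4] at hv
    simp [hw0] at hv

lemma exists_rec_s8 (a : ℤ → ℂ) (n : ℕ) (hE : ∀ m, piE a n m) :
    ∃ p : ℂ[X], p ≠ 0 ∧ ∀ m, piS a p m = 0 := by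
  induction n with
  | zero =>
    obtain ⟨p, hp0, hp, -⟩ := hE 0
    exfalso
    apply hp0
    rw [← Polynomial.degree_eq_bot]
    simpa using hp
  | succ n ih =>
    by_cases h : ∀ m, piE a n m
    · exact ih h
    push Not at h
    obtain ⟨m, hN⟩ := h
    obtain ⟨p, hp0, hp, kp⟩ := hE m
    have key : ∀ j : ℤ, ¬ piE a n j ∧ ∀ i : ℕ, i < n + 1 → piS a p (j + i) = 0 := by
      intro j
      induction j using Int.inductionOn' (b := m) with
      | zero => exact ⟨hN, kp⟩
      | succ k hk ih =>
        obtain ⟨h1, h2⟩ := ih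
        have c := core hE h1 hp hp0 (fun i hi => h2 i (by omega))
        have k' : ∀ i : ℕ, i < n → piS a p (k + 1 + i) = 0 := fun i hi => by
          have := h2 (i + 1) (by omega)
          push_cast at this
          rwa [show k + ((i : ℤ) + 1) = k + 1 + i by ring] at this
        have c' := core hE c.2.2.2.1 hp hp0 k'
        refine ⟨c.2.2.2.1, fun i hi => ?_⟩
        rcases Nat.lt_succ_iff_lt_or_eq.1 hi with hi | rfl
        · exact k' i hi
        · exact c'.2.2.1
      | pred k hk ih =>
        obtain ⟨h1, h2⟩ := ih
        have c := core hE h1 hp hp0 (fun i hi => h2 i (by omega))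
        refine ⟨c.2.2.2.2, fun i hi => ?_⟩
        rcases i with _ | i
        · simpa using c.2.1
        · push_cast
          rw [show k - 1 + ((i : ℤ) + 1) = k + i by ring]
          exact h2 i (by omega)
    refine ⟨p, hp0, fun j => ?_⟩
    simpa using (key j).2 0 (by omega)

lemma piE_of_det (a : ℤ → ℂ) (n : ℕ) (m : ℤ)
    (h : Matrix.det (Matrix.of fun i j : Fin n => a (m + (i : ℕ) + (j : ℕ))) = 0) :
    piE a n m := by
  obtain ⟨v, hv0, hv⟩ := Matrix.exists_mulVec_eq_zero_iff.2 h
  refine ⟨∑ k : Fin n, C (v k) * X ^ (k : ℕ), ?_, ?_, ?_⟩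
  · intro h0
    apply hv0
    ext k
    have := congrArg (fun z => z.coeff (k : ℕ)) h0
    simpa [coeff_X_pow, ← Fin.ext_iff] using this
  · exact Polynomial.degree_sum_fin_lt v
  · intro i hi
    have := congrFun hv ⟨i, hi⟩
    simp only [Matrix.mulVec, dotProduct, Matrix.of_apply, Pi.zero_apply] at this
    rw [← this]
    unfold piS
    rw [Polynomial.sum_over_range' _ (by simp) n]
    · rw [← Fin.sum_univ_eq_sum_range (fun k => _ * a (m + i + k))]
      refine Finset.sum_congr rfl fun k _ => ?_
      rw [mul_comm]
      congr 1
      simp [coeff_X_pow, ← Fin.ext_iff]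
    · rw [Polynomial.natDegree_lt_iff_degree_lt]
      · exact Polynomial.degree_sum_fin_lt v
      · intro h0
        apply hv0
        ext k
        have := congrArg (fun z => z.coeff (k : ℕ)) h0
        simpa [coeff_X_pow, ← Fin.ext_iff] using this

section
open MeasureTheory UnitAddTorus
noncomputable local instance : MeasureSpace UnitAddCircle := ⟨AddCircle.haarAddCircle⟩
local instance : Measure.IsAddHaarMeasure (volume : Measure UnitAddCircle) :=
  inferInstanceAs (Measure.IsAddHaarMeasure AddCircle.haarAddCircle)
local instance : IsProbabilityMeasure (volume : Measure UnitAddCircle) :=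
  inferInstanceAs (IsProbabilityMeasure AddCircle.haarAddCircle)

lemma mF_add {d : ℕ} (α : Fin d → ℤ) (x y : UnitAddTorus (Fin d)) :
    mFourier α (x + y) = mFourier α x * mFourier α y := by
  simp [mFourier, fourier_apply, Finset.prod_mul_distrib, AddCircle.toCircle_add, smul_add]

lemma mF_pt_zero {d : ℕ} (α : Fin d → ℤ) : mFourier α (0 : UnitAddTorus (Fin d)) = 1 := by
  simp [mFourier]

lemma mF_nsmul {d : ℕ} (α : Fin d → ℤ) (k : ℕ) (x : UnitAddTorus (Fin d)) :
    mFourier α (k • x) = mFourier α x ^ k := by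
  induction k with
  | zero => simp [mF_pt_zero]
  | succ k ih => rw [succ_nsmul, mF_add, ih, pow_succ]

lemma mF_ne {d : ℕ} (α : Fin d → ℤ) (x : UnitAddTorus (Fin d)) : mFourier α x ≠ 0 := by
  simp [mFourier, fourier_apply, Finset.prod_ne_zero_iff]

lemma coeff_translate {d : ℕ} (g : C(UnitAddTorus (Fin d), ℂ)) (y : UnitAddTorus (Fin d))
    (α : Fin d → ℤ) :
    mFourierCoeff (fun t => g (t + y)) α = mFourier α y * mFourierCoeff g α := by
  unfold mFourierCoeff
  rw [← integral_add_right_eq_self (fun t => mFourier (-α) t • g t) y, ← integral_const_mul]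
  congr 1
  ext t
  have : mFourier α y * mFourier (-α) y = 1 := by
    rw [← mFourier_add]; simp [mFourier_zero]
  rw [mF_add]
  simp only [smul_eq_mul]
  linear_combination (-(mFourier (-α) t) * g (t + y)) * this

lemma eq_sum_of_coeff {d : ℕ} (g : C(UnitAddTorus (Fin d), ℂ)) (F : Finset (Fin d → ℤ))
    (h : ∀ α, α ∉ F → mFourierCoeff g α = 0) (x : UnitAddTorus (Fin d)) :
    g x = ∑ α ∈ F, mFourierCoeff g α * mFourier α x := by
  have h1 := hasSum_mFourier_series_apply_of_summable
    (f := g) (summable_of_ne_finset_zero (L := .unconditional _) (s := F) (fun α hα => h α hα)) x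
  have h2 := hasSum_sum_of_ne_finset_zero (L := .unconditional _) (s := F) (f := fun α => mFourierCoeff g α • mFourier α x)
    (fun α hα => by simp [h α hα])
  simpa using h1.unique h2

lemma dense_orbit {d : ℕ} (θ : UnitAddTorus (Fin d)) (hθ : ∀ α, mFourier α θ = 1 → α = 0) :
    Dense (Set.range fun m : ℤ => m • θ) := by
  set S := Set.range fun m : ℤ => m • θ with hS
  have hS0 : (0 : UnitAddTorus (Fin d)) ∈ S := ⟨0, by simp⟩
  let φ : C(UnitAddTorus (Fin d), ℂ) :=
    ⟨fun x => (Metric.infDist x S : ℂ),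
      Complex.continuous_ofReal.comp (Metric.continuous_infDist_pt S)⟩
  have himg : (fun x => x + θ) '' S = S := by
    ext x
    constructor
    · rintro ⟨_, ⟨m, rfl⟩, rfl⟩
      exact ⟨m + 1, by simp [add_smul]⟩
    · rintro ⟨m, rfl⟩
      exact ⟨(m - 1) • θ, ⟨m - 1, rfl⟩, by simp [sub_smul]⟩
  have hiso : Isometry (fun x : UnitAddTorus (Fin d) => x + θ) :=
    Isometry.of_dist_eq fun x y => dist_add_right x y θ
  have hinv : ∀ x, φ (x + θ) = φ x := by
    intro x
    have := Metric.infDist_image (x := x) (t := S) hiso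
    rw [himg] at this
    simp [φ, this]
  have hc : ∀ α, α ∉ ({0} : Finset (Fin d → ℤ)) → mFourierCoeff φ α = 0 := by
    intro α hα
    have h1 := coeff_translate φ θ α
    simp only [hinv] at h1
    have h2 : (mFourier α θ - 1) * mFourierCoeff φ α = 0 := by
      rw [sub_mul, ← h1]; simp
    rcases mul_eq_zero.1 h2 with h | h
    · exact absurd (hθ α (sub_eq_zero.1 h)) (by simpa using hα)
    · exact h
  have hval : ∀ x, φ x = φ 0 := by
    intro x
    rw [eq_sum_of_coeff φ _ hc x, eq_sum_of_coeff φ _ hc 0]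
    simp [mFourier_zero]
  intro x
  rw [Metric.mem_closure_iff_infDist_zero ⟨_, hS0⟩]
  have h1 := hval x
  have h2 : Metric.infDist 0 S = 0 := Metric.infDist_zero_of_mem hS0
  simpa [φ, h2] using h1

lemma finite_coeff {d : ℕ} (g : C(UnitAddTorus (Fin d), ℂ)) (θ : UnitAddTorus (Fin d))
    (hθ : ∀ α, mFourier α θ = 1 → α = 0) (p : ℂ[X]) (hp : p ≠ 0)
    (h : ∀ x, ∑ k ∈ p.support, p.coeff k * g (x + k • θ) = 0) :
    ∃ F : Finset (Fin d → ℤ), ∀ α, α ∉ F → mFourierCoeff g α = 0 := by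
  have hinj : Function.Injective fun α : Fin d → ℤ => mFourier α θ := by
    intro α β hab
    simp only at hab
    have : mFourier (α + -β) θ = 1 := by
      rw [mFourier_add, hab, ← mFourier_add]; simp [mFourier_zero]
    have := hθ _ this
    rwa [← sub_eq_add_neg, sub_eq_zero] at this
  refine ⟨p.roots.toFinset.preimage _ hinj.injOn, fun α hα => ?_⟩
  have h1 : p.eval (mFourier α θ) ≠ 0 := by
    simpa [hp] using hα
  have h2 : p.eval (mFourier α θ) * mFourierCoeff g α = 0 := by
    rw [Polynomial.eval_eq_sum, Polynomial.sum_def, Finset.sum_mul]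
    have : ∀ k : ℕ, p.coeff k * mFourier α θ ^ k * mFourierCoeff g α
        = ∫ t, p.coeff k * (mFourier (-α) t • g (t + k • θ)) := by
      intro k
      rw [integral_const_mul, mul_assoc, ← mF_nsmul, ← coeff_translate]
      rfl
    simp only [this]
    rw [← integral_finsetSum]
    · convert integral_zero (UnitAddTorus (Fin d)) ℂ with t
      rw [← mul_zero (mFourier (-α) t), ← h t, Finset.mul_sum]
      refine Finset.sum_congr rfl fun k _ => ?_
      simp only [smul_eq_mul]; ring
    · intro k _
      apply Continuous.integrable_of_hasCompactSupport
      · fun_prop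
      · exact HasCompactSupport.of_compactSpace _
  exact (mul_eq_zero.1 h2).resolve_left h1

lemma torus_main {d : ℕ} (g : C(UnitAddTorus (Fin d), ℂ)) (θ : UnitAddTorus (Fin d))
    (hθ : ∀ α, mFourier α θ = 1 → α = 0)
    (p : ℂ[X]) (hp : p ≠ 0)
    (h : ∀ m : ℤ, ∑ k ∈ p.support, p.coeff k * g (m • θ + k • θ) = 0) :
    ∃ (F : Finset (Fin d → ℤ)) (c : (Fin d → ℤ) → ℂ), ∀ x,
      g x = ∑ α ∈ F, c α * mFourier α x := by
  have : ∀ x, ∑ k ∈ p.support, p.coeff k * g (x + k • θ) = 0 := by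
    have := Continuous.ext_on (dense_orbit θ hθ)
      (f := fun x => ∑ k ∈ p.support, p.coeff k * g (x + k • θ)) (g := fun _ => 0)
      (by fun_prop) continuous_const (by rintro _ ⟨m, rfl⟩; exact h m)
    exact fun x => congrFun this x
  obtain ⟨F, hF⟩ := finite_coeff g θ hθ p hp this
  exact ⟨F, _, fun x => eq_sum_of_coeff g F hF x⟩
end
lemma mF_coe {d : ℕ} (α : Fin d → ℤ) (x : Fin d → ℝ) :
    UnitAddTorus.mFourier α (fun k => ((x k : ℝ) : UnitAddCircle)) =
      Complex.exp (2 * Real.pi * Complex.I * ∑ k, (α k : ℂ) * (x k : ℂ)) := by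
  simp only [UnitAddTorus.mFourier, ContinuousMap.coe_mk, Finset.mul_sum, Complex.exp_sum]
  refine Finset.prod_congr rfl fun k _ => ?_
  rw [fourier_coe_apply]
  congr 1
  push_cast
  ring

lemma exists_generic (d : ℕ) : ∃ h : Fin d → ℝ, ∀ α : Fin d → ℤ,
    UnitAddTorus.mFourier α (fun k => ((h k : ℝ) : UnitAddCircle)) = 1 → α = 0 := by
  have ht : Transcendental ℤ (liouvilleNumber ((2 : ℕ) : ℝ)) :=
    transcendental_liouvilleNumber le_rfl
  set t := liouvilleNumber ((2 : ℕ) : ℝ)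
  refine ⟨fun k => t ^ ((k : ℕ) + 1), fun α hα => ?_⟩
  rw [mF_coe, Complex.exp_eq_one_iff] at hα
  obtain ⟨z, hz⟩ := hα
  have h1 : ∑ k, (α k : ℂ) * ((t ^ ((k : ℕ) + 1) : ℝ) : ℂ) = z := by
    have : (2 * Real.pi * Complex.I : ℂ) ≠ 0 := by simp [Real.pi_ne_zero]
    apply mul_left_cancel₀ this
    rw [hz]; ring
  have h2 : ∑ k, (α k : ℝ) * t ^ ((k : ℕ) + 1) = z := by exact_mod_cast h1
  have h3 : (∑ k : Fin d, C (α k) * X ^ ((k : ℕ) + 1) - C z : ℤ[X]) = 0 := by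
    apply (transcendental_iff.1 ht)
    simp [h2]
  ext k
  have := congrArg (fun q => q.coeff ((k : ℕ) + 1)) h3
  simp only [coeff_sub, finsetSum_coeff, coeff_C_mul, coeff_X_pow, coeff_C_succ, coeff_zero] at this
  simpa [← Fin.ext_iff] using this

lemma per_all {d : ℕ} (f : (Fin d → ℝ) → ℂ) (T : Fin d → ℝ)
    (hper : ∀ (k : Fin d) (a : Fin d → ℝ) (t : ℝ),
      f (Function.update a k (t + T k)) = f (Function.update a k t))
    (x y : Fin d → ℝ) (h : ∀ k, ∃ z : ℤ, y k = x k + z * T k) : f y = f x := by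
  have key : ∀ s : Finset (Fin d), f (s.piecewise y x) = f x := by
    intro s
    induction s using Finset.induction_on with
    | empty => simp
    | insert j s hj ih =>
      rw [Finset.piecewise_insert]
      obtain ⟨z, hz⟩ := h j
      have hp : Function.Periodic (fun t => f (Function.update (s.piecewise y x) j t)) (T j) :=
        fun t => hper j _ t
      have := hp.int_mul z (x j)
      rw [hz, this, ← ih]
      congr 1
      rw [Function.update_eq_self_iff]
      simp [hj]
  simpa using key Finset.univ

lemma exists_lift {d : ℕ} (f : (Fin d → ℝ) → ℂ) (hf : Continuous f) (T : Fin d → ℝ)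
    (hper : ∀ (k : Fin d) (a : Fin d → ℝ) (t : ℝ),
      f (Function.update a k (t + T k)) = f (Function.update a k t)) :
    ∃ g : C(UnitAddTorus (Fin d), ℂ), ∀ x : Fin d → ℝ,
      g (fun k => ((x k : ℝ) : UnitAddCircle)) = f (fun k => x k * T k) := by
  have hq : IsOpenQuotientMap (Pi.map fun (_ : Fin d) (x : ℝ) => (x : UnitAddCircle)) :=
    IsOpenQuotientMap.piMap fun _ => QuotientAddGroup.isOpenQuotientMap_mk
  let σ := Function.surjInv hq.surjective
  have key : ∀ x : Fin d → ℝ,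
      f (fun k => σ (Pi.map (fun (_ : Fin d) (x : ℝ) => (x : UnitAddCircle)) x) k * T k)
        = f (fun k => x k * T k) := by
    intro x
    apply per_all f T hper
    intro k
    have h1 := congrFun (Function.surjInv_eq hq.surjective
      (Pi.map (fun (_ : Fin d) (x : ℝ) => (x : UnitAddCircle)) x)) k
    simp only [Pi.map_apply] at h1
    have h2 : ((σ (Pi.map (fun (_ : Fin d) (x : ℝ) => (x : UnitAddCircle)) x) k - x k : ℝ) :
        UnitAddCircle) = 0 := by
      rw [AddCircle.coe_sub, sub_eq_zero]
      exact h1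
    obtain ⟨z, hz⟩ := (AddCircle.coe_eq_zero_iff _).1 h2
    refine ⟨z, ?_⟩
    simp only [zsmul_eq_mul, mul_one] at hz
    rw [hz]
    ring
  refine ⟨⟨fun y => f (fun k => σ y k * T k), ?_⟩, key⟩
  rw [hq.isQuotientMap.continuous_iff]
  have : (fun y => f (fun k => σ y k * T k)) ∘
    (Pi.map fun (_ : Fin d) (x : ℝ) => (x : UnitAddCircle)) = fun x => f (fun k => x k * T k) :=
    funext key
  rw [this]
  fun_prop

end PIhelpers

/-- A continuous solution `f : ℝ^d → ℂ` of the Popoviciu–Ionescu functional equation of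
order `n` in `ℝ^d` which is separately periodic in each variable (with periods
`T 1, …, T d > 0`) is a trigonometric polynomial in `d` variables with those periods. -/
theorem stmt_8 (d n : ℕ) (f : (Fin d → ℝ) → ℂ) (hf : Continuous f)
    (heq : ∀ x h : Fin d → ℝ,
      Matrix.det (Matrix.of fun i j : Fin (n + 1) =>
        f (x + ((i : ℕ) + (j : ℕ)) • h)) = 0)
    (T : Fin d → ℝ) (hT : ∀ k, 0 < T k)
    (hper : ∀ (k : Fin d) (a : Fin d → ℝ) (t : ℝ),
      f (Function.update a k (t + T k)) = f (Function.update a k t)) :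
    ∃ (F : Finset (Fin d → ℤ)) (c : (Fin d → ℤ) → ℂ), ∀ x : Fin d → ℝ,
      f x = ∑ α ∈ F, c α *
        Complex.exp (2 * Real.pi * Complex.I * ∑ k, (α k : ℂ) * (x k : ℂ) / (T k : ℂ)) := by
  obtain ⟨g, hg⟩ := exists_lift f hf T hper
  obtain ⟨h, hh⟩ := exists_generic d
  set θ : UnitAddTorus (Fin d) := fun k => ((h k : ℝ) : UnitAddCircle) with hθ
  have hgm : ∀ m : ℤ, g (m • θ) = f (m • fun k => h k * T k) := by
    intro m
    have h1 := hg (fun k => m * h k)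
    have h2 : (fun k => ((m * h k : ℝ) : UnitAddCircle)) = m • θ := by
      ext k
      simp only [hθ, Pi.smul_apply]
      rw [← AddCircle.coe_zsmul, zsmul_eq_mul]
    rw [← h2, h1]
    congr 1
    ext k
    simp [mul_assoc]
  obtain ⟨p, hp, hrec⟩ := exists_rec_s8 (fun m => f (m • fun k => h k * T k)) (n + 1) (by
    intro m
    apply piE_of_det
    rw [← heq (m • fun k => h k * T k) (fun k => h k * T k)]
    congr 1
    ext i j
    simp only [Matrix.of_apply]
    congr 1
    ext k
    simp
    ring)
  obtain ⟨F, c, hF⟩ := torus_main g θ hh p hp (by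
    intro m
    rw [← hrec m]
    unfold piS
    rw [Polynomial.sum_def]
    refine Finset.sum_congr rfl fun k _ => ?_
    beta_reduce
    rw [← hgm, add_smul, natCast_zsmul])
  refine ⟨F, c, fun x => ?_⟩
  have h1 := hg (fun k => x k / T k)
  have h2 : (fun k => x k / T k * T k) = x := by
    ext k
    exact div_mul_cancel₀ _ (hT k).ne'
  rw [h2] at h1
  rw [← h1, hF]
  refine Finset.sum_congr rfl fun α _ => ?_
  rw [mF_coe]
  simp [mul_div_assoc]
end
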